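/- (Schupp) Let G, H and K be nontrivial groups with |K| ≥ 3 and with the cardinality of G at most the cardinality of the free product H ∗ K. Then there exists a simple group S, an injective group homomorphism φ : G → S, and injective group homomorphisms ψ : H → S and χ : K → S such that S is generated by the union of the images ψ(H) and χ(K). -/

import Mathlib

universe u v

namespace SchuppEmbedding

open Equiv Cardinal
open scoped commutatorElement

section ThreeCycles
variable {Y : Type u}
open scoped Classical

/-- The permutation `a ↦ b ↦ c ↦ a` (for distinct `a`, `b`, `c`). -/
noncomputable def threeCycle (a b c : Y) : Perm Y := swap a b * swap b c

theorem conj_threeCycle (f : Perm Y) (a b c : Y) :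
    f * threeCycle a b c * f⁻¹ = threeCycle (f a) (f b) (f c) := by
  simp only [threeCycle, swap_apply_apply]; group

theorem threeCycle_apply_first {a b c : Y} (hab : a ≠ b) (hac : a ≠ c) :
    threeCycle a b c a = b := by
  simp [threeCycle, swap_apply_of_ne_of_ne hab hac]

theorem threeCycle_apply_second (a b c : Y) (hac : a ≠ c) (hbc : b ≠ c) :
    threeCycle a b c b = c := by
  simp [threeCycle, swap_apply_of_ne_of_ne hac.symm hbc.symm]

theorem threeCycle_apply_third (a b c : Y) : threeCycle a b c c = a := by
  simp [threeCycle]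

theorem threeCycle_apply_of_ne {a b c x : Y} (ha : x ≠ a) (hb : x ≠ b) (hc : x ≠ c) :
    threeCycle a b c x = x := by
  simp [threeCycle, swap_apply_of_ne_of_ne ha hb, swap_apply_of_ne_of_ne hb hc]

theorem threeCycle_rotate {a b c : Y} (hab : a ≠ b) (hac : a ≠ c) (hbc : b ≠ c) :
    threeCycle b c a = threeCycle a b c := by
  have h := conj_threeCycle (threeCycle a b c) a b c
  rw [threeCycle_apply_first hab hac, threeCycle_apply_second a b c hac hbc,
    threeCycle_apply_third] at h
  rw [← h]; group

theorem threeCycle_inv (a b c : Y) : (threeCycle a b c)⁻¹ = threeCycle c b a := by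
  simp [threeCycle, swap_comm]

/-- If the supports of `f` and `g` meet only in `d`, then `⁅f, g⁆` is a three-cycle. -/
theorem commutator_eq_threeCycle {f g : Perm Y} {d : Y} (hf : f d ≠ d) (hg : g d ≠ d)
    (h : ∀ y, y ≠ d → f y = y ∨ g y = y) : ⁅f, g⁆ = threeCycle d (f d) (g d) := by
  have gf : g (f d) = f d := (h _ hf).resolve_left fun h => hf (f.injective h)
  have fg : f (g d) = g d := (h _ hg).resolve_right fun h => hg (g.injective h)
  have hfg : f d ≠ g d := fun e => hf (by
    have := fg; rw [← e] at this; exact f.injective this)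
  rw [commutatorElement_def, mul_inv_eq_iff_eq_mul, mul_inv_eq_iff_eq_mul]
  ext y
  simp only [Perm.mul_apply]
  by_cases hyd : y = d
  · subst hyd
    rw [fg, gf, threeCycle_apply_second _ _ _ hg.symm hfg]
  by_cases hy1 : f y = d
  · have hgy : g y = y := (h y hyd).resolve_left fun e => hyd (by rw [← e, hy1])
    rw [hgy, hy1, threeCycle_apply_third]
  by_cases hy2 : g y = d
  · have hfy : f y = y := (h y hyd).resolve_right fun e => hyd (by rw [← e, hy2])
    rw [hfy, hy2, threeCycle_apply_first hf.symm hg.symm]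
  rcases h y hyd with hfy | hgy
  · rw [hfy]
    have hgfd : g y ≠ f d := fun e => hf (by
      have : y = f d := g.injective (e.trans gf.symm)
      exact f.injective (by rw [← this, hfy]))
    have : f (g y) = g y := (h _ hy2).elim id fun e => by
      have := g.injective e; rw [this, hfy]
    rw [this, threeCycle_apply_of_ne hy2 hgfd]
    exact fun e => hyd (g.injective e)
  · rw [hgy]
    have : g (f y) = f y := (h _ hy1).elim (fun e => by
      have := f.injective e; rw [this, hgy]) id
    have hfgd : f y ≠ g d := fun e => hg (by
      have : y = g d := f.injective (e.trans fg.symm)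
      exact g.injective (by rw [← this, hgy]))
    rw [this, threeCycle_apply_of_ne hy1 (fun e => hyd (f.injective e)) hfgd]
end ThreeCycles

section Growth
variable {Y : Type u}

/-- All three-cycles on points of `S` belong to `C`. -/
def ContainsThreeCycles (C : Subgroup (Perm Y)) (S : Set Y) : Prop :=
  ∀ a ∈ S, ∀ b ∈ S, ∀ c ∈ S, a ≠ b → a ≠ c → b ≠ c → threeCycle a b c ∈ C

/-- The points that lie in a three-cycle of `C` starting with `a ↦ b`. -/
def threeCycleSpan (C : Subgroup (Perm Y)) (a b : Y) : Set Y :=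
  {x | x = a ∨ x = b ∨ x ≠ a ∧ x ≠ b ∧ threeCycle a b x ∈ C}

variable {C : Subgroup (Perm Y)}

theorem threeCycle_rotate_mem {a b c : Y} (hab : a ≠ b) (hac : a ≠ c) (hbc : b ≠ c)
    (h : threeCycle a b c ∈ C) : threeCycle b c a ∈ C := by
  rwa [threeCycle_rotate hab hac hbc]

theorem threeCycle_reverse_mem {a b c : Y} (h : threeCycle a b c ∈ C) :
    threeCycle c b a ∈ C := by
  rw [← threeCycle_inv]; exact inv_mem h

theorem containsThreeCycles_threeCycleSpan {a b : Y} (hab : a ≠ b) :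
    ContainsThreeCycles C (threeCycleSpan C a b) := by
  have k1 : ∀ x y, x ≠ a → x ≠ b → y ≠ a → y ≠ b → x ≠ y → threeCycle a b x ∈ C →
      threeCycle a b y ∈ C → threeCycle b y x ∈ C := by
    intro x y hxa hxb hya hyb hxy hx hy
    have := C.mul_mem (C.mul_mem hy hx) (inv_mem hy)
    rwa [conj_threeCycle, threeCycle_apply_first hab hya.symm,
      threeCycle_apply_second _ _ _ hya.symm hyb.symm, threeCycle_apply_of_ne hxa hxb hxy] at this
  have k2 : ∀ x y, x ≠ a → x ≠ b → y ≠ a → y ≠ b → x ≠ y → threeCycle a b x ∈ C →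
      threeCycle a b y ∈ C → threeCycle a x y ∈ C := by
    intro x y hxa hxb hya hyb hxy hx hy
    have hy' := threeCycle_reverse_mem hy
    have := C.mul_mem (C.mul_mem hy' hx) (inv_mem hy')
    rw [conj_threeCycle, threeCycle_apply_third, threeCycle_apply_second _ _ _ hya hab.symm,
      threeCycle_apply_of_ne hxy hxb hxa] at this
    exact threeCycle_rotate_mem hya hxy.symm hxa.symm this
  have k3 : ∀ x y z, x ≠ a → x ≠ b → y ≠ a → y ≠ b → z ≠ a → z ≠ b → x ≠ y → x ≠ z → y ≠ z →
      threeCycle a b x ∈ C → threeCycle a b y ∈ C → threeCycle a b z ∈ C →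
      threeCycle x y z ∈ C := by
    intro x y z hxa hxb hya hyb hza hzb hxy hxz hyz hx hy hz
    have h1 := k1 y x hya hyb hxa hxb hxy.symm hy hx
    have := C.mul_mem (C.mul_mem hz h1) (inv_mem hz)
    rw [conj_threeCycle, threeCycle_apply_second _ _ _ hza.symm hzb.symm,
      threeCycle_apply_of_ne hxa hxb hxz, threeCycle_apply_of_ne hya hyb hyz] at this
    exact threeCycle_rotate_mem hxz.symm hyz.symm hxy this
  have rot := @threeCycle_rotate_mem _ C
  have rev := @threeCycle_reverse_mem _ C
  rintro u (rfl | rfl | ⟨hu1, hu2, hu⟩) v (rfl | rfl | ⟨hv1, hv2, hv⟩)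
    w (rfl | rfl | ⟨hw1, hw2, hw⟩) huv huw hvw <;> first | contradiction | skip
  all_goals clear hab
  all_goals grind
theorem ContainsThreeCycles.subset_threeCycleSpan {S : Set Y} (h : ContainsThreeCycles C S)
    {a b : Y} (ha : a ∈ S) (hb : b ∈ S) (hab : a ≠ b) : S ⊆ threeCycleSpan C a b := by
  intro x hx
  by_cases h1 : x = a
  · exact Or.inl h1
  by_cases h2 : x = b
  · exact Or.inr (Or.inl h2)
  exact Or.inr (Or.inr ⟨h1, h2, h a ha b hb x hx hab (Ne.symm h1) (Ne.symm h2)⟩)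

theorem ContainsThreeCycles.mono {S S' : Set Y} (h : ContainsThreeCycles C S) (hS : S' ⊆ S) :
    ContainsThreeCycles C S' :=
  fun a ha b hb c hc => h a (hS ha) b (hS hb) c (hS hc)

/-- Two sets with a common point, each with at least three points, can be merged. -/
theorem ContainsThreeCycles.subset_of_common {S : Set Y} {a b c : Y} (hab : a ≠ b) (hac : a ≠ c)
    (hbc : b ≠ c) (hc : c ∈ threeCycleSpan C a b) (hS : ContainsThreeCycles C S) {p q r : Y}
    (hp : p ∈ threeCycleSpan C a b) (hpS : p ∈ S) (hq : q ∈ S) (hr : r ∈ S)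
    (hpq : p ≠ q) (hpr : p ≠ r) (hqr : q ≠ r) : S ⊆ threeCycleSpan C a b := by
  set W := threeCycleSpan C a b with hW
  have hWg : ContainsThreeCycles C W := containsThreeCycles_threeCycleSpan hab
  have haW : a ∈ W := Or.inl rfl
  have hbW : b ∈ W := Or.inr (Or.inl rfl)
  -- if `S` meets `W` in two points, it is contained in `W`
  have two : ∀ S : Set Y, ContainsThreeCycles C S → ∀ x ∈ S, ∀ y ∈ S, x ≠ y → x ∈ W → y ∈ W →
      S ⊆ W := by
    intro S hS x hx y hy hxy hxW hyW
    have hV : ContainsThreeCycles C (threeCycleSpan C x y) :=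
      containsThreeCycles_threeCycleSpan hxy
    have h1 : W ⊆ threeCycleSpan C x y := hWg.subset_threeCycleSpan hxW hyW hxy
    have h2 := hV.subset_threeCycleSpan (h1 haW) (h1 hbW) hab
    exact (hS.subset_threeCycleSpan hx hy hxy).trans h2
  by_cases hqW : q ∈ W
  · exact two S hS p hpS q hq hpq hp hqW
  by_cases hrW : r ∈ W
  · exact two S hS p hpS r hr hpr hp hrW
  obtain ⟨x, y, hxW, hyW, hxp, hyp, hxy⟩ : ∃ x y, x ∈ W ∧ y ∈ W ∧ x ≠ p ∧ y ≠ p ∧ x ≠ y := by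
    by_cases h1 : a = p
    · exact ⟨b, c, hbW, hc, by rw [← h1]; exact hab.symm, by rw [← h1]; exact hac.symm, hbc⟩
    by_cases h2 : b = p
    · exact ⟨a, c, haW, hc, h1, by rw [← h2]; exact hbc.symm, hac⟩
    exact ⟨a, b, haW, hbW, h1, h2, hab⟩
  have hxq : x ≠ q := fun h => hqW (h ▸ hxW)
  have hxr : x ≠ r := fun h => hrW (h ▸ hxW)
  have hyq : y ≠ q := fun h => hqW (h ▸ hyW)
  have hyr : y ≠ r := fun h => hrW (h ▸ hyW)
  have m1 : threeCycle p x y ∈ C := hWg p hp x hxW y hyW hxp.symm hyp.symm hxy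
  have m2 : threeCycle p q r ∈ C := hS p hpS q hq r hr hpq hpr hqr
  have m3 : threeCycle p x q ∈ C := by
    have e := commutator_eq_threeCycle (f := threeCycle p x y) (g := threeCycle p q r) (d := p)
      (by rw [threeCycle_apply_first hxp.symm hyp.symm]; exact hxp)
      (by rw [threeCycle_apply_first hpq hpr]; exact hpq.symm)
      (by
        intro z hz
        by_cases h : z = x ∨ z = y
        · right
          rcases h with rfl | rfl
          · exact threeCycle_apply_of_ne hz hxq hxr
          · exact threeCycle_apply_of_ne hz hyq hyr
        · push Not at h
          exact Or.inl (threeCycle_apply_of_ne hz h.1 h.2))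
    rw [threeCycle_apply_first hxp.symm hyp.symm, threeCycle_apply_first hpq hpr] at e
    rw [← e]
    exact C.mul_mem (C.mul_mem (C.mul_mem m1 m2) (inv_mem m1)) (inv_mem m2)
  have hV : ContainsThreeCycles C (threeCycleSpan C p x) :=
    containsThreeCycles_threeCycleSpan hxp.symm
  have h1 := two _ hV p (Or.inl rfl) x (Or.inr (Or.inl rfl)) hxp.symm hp hxW
  exact absurd (h1 (Or.inr (Or.inr ⟨hpq.symm, hxq.symm, m3⟩))) hqW

variable {Q R : Type*} [Group Q] [Group R]

/-- Starting from one three-cycle, conjugation generates all three-cycles. -/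
theorem threeCycle_mem_of_growth (α : Q →* Perm Y) (ρ : R →* Perm Y) (E : Set Y)
    (hE : ∀ r, ∀ y ∈ E, ρ r y = y)
    (hα : ∀ q, ∀ σ ∈ C, α q * σ * (α q)⁻¹ ∈ C)
    (hρ : ∀ r, ∀ σ ∈ C, (∀ y ∈ E, σ y = y) → ρ r * σ * (ρ r)⁻¹ ∈ C)
    {d b c : Y} (hdb : d ≠ b) (hdc : d ≠ c) (hbc : b ≠ c) (hd : d ∉ E) (hb : b ∉ E) (hc : c ∉ E)
    (hdbc : threeCycle d b c ∈ C) (hdα : ∀ q, α q d = d)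
    (hmeet : ∀ r, ∃ y ∈ ({d, b, c} : Set Y), ρ r y ∈ ({d, b, c} : Set Y))
    (htrans : ∀ S : Set Y, d ∈ S → (∀ q, ∀ y ∈ S, α q y ∈ S) → (∀ r, ∀ y ∈ S, ρ r y ∈ S) →
      S = Set.univ)
    {x y z : Y} (hxy : x ≠ y) (hxz : x ≠ z) (hyz : y ≠ z) : threeCycle x y z ∈ C := by
  set W := threeCycleSpan C d b with hW
  have hWg : ContainsThreeCycles C W := containsThreeCycles_threeCycleSpan hdb
  have hdW : d ∈ W := Or.inl rfl
  have hbW : b ∈ W := Or.inr (Or.inl rfl)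
  have hcW : c ∈ W := Or.inr (Or.inr ⟨hdc.symm, hbc.symm, hdbc⟩)
  have hsub : ({d, b, c} : Set Y) ⊆ W := by
    rintro y (rfl | rfl | rfl) <;> assumption
  have conj_good : ∀ (f : Perm Y) (S : Set Y), ContainsThreeCycles C S →
      (∀ σ, (∀ y, y ∉ S → σ y = y) → σ ∈ C → f * σ * f⁻¹ ∈ C) →
      ContainsThreeCycles C (f '' S) := by
    rintro f S hS hf _ ⟨u, hu, rfl⟩ _ ⟨v, hv, rfl⟩ _ ⟨w, hw, rfl⟩ huv huw hvw
    rw [← conj_threeCycle]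
    refine hf _ (fun y hy => ?_) (hS u hu v hv w hw (fun h => huv (h ▸ rfl))
      (fun h => huw (h ▸ rfl)) (fun h => hvw (h ▸ rfl)))
    exact threeCycle_apply_of_ne (fun h => hy (h ▸ hu)) (fun h => hy (h ▸ hv))
      (fun h => hy (h ▸ hw))
  have key : W = Set.univ := by
    refine htrans W hdW (fun q y hy => ?_) (fun r y hy => ?_)
    · have hg := conj_good (α q) W hWg (fun σ _ hσ => hα q σ hσ)
      exact ContainsThreeCycles.subset_of_common hdb hdc hbc hcW hg hdW ⟨d, hdW, hdα q⟩
        ⟨b, hbW, rfl⟩ ⟨c, hcW, rfl⟩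
        (fun h => hdb ((α q).injective ((hdα q).trans h)))
        (fun h => hdc ((α q).injective ((hdα q).trans h)))
        (fun h => hbc ((α q).injective h)) ⟨y, hy, rfl⟩
    · by_cases hyE : y ∈ E
      · rwa [hE r y hyE]
      have hT : ContainsThreeCycles C (insert y {d, b, c} : Set Y) :=
        hWg.mono (Set.insert_subset hy hsub)
      have hg := conj_good (ρ r) _ hT (fun σ h hσ => hρ r σ hσ (fun w hw => h w (by
        rintro (rfl | rfl | rfl | rfl) <;> contradiction)))
      obtain ⟨p, hp, hp'⟩ := hmeet r
      have sub3 : ({d, b, c} : Set Y) ⊆ insert y {d, b, c} := Set.subset_insert _ _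
      have hdm : d ∈ ({d, b, c} : Set Y) := by simp
      have hbm : b ∈ ({d, b, c} : Set Y) := by simp
      have hcm : c ∈ ({d, b, c} : Set Y) := by simp
      obtain ⟨u, v, hu, hv, hpu, hpv, huv⟩ : ∃ u v, u ∈ ({d, b, c} : Set Y) ∧
          v ∈ ({d, b, c} : Set Y) ∧ p ≠ u ∧ p ≠ v ∧ u ≠ v := by
        rcases hp with rfl | rfl | rfl
        · exact ⟨b, c, hbm, hcm, hdb, hdc, hbc⟩
        · exact ⟨d, c, hdm, hcm, hdb.symm, hbc, hdc⟩
        · exact ⟨d, b, hdm, hbm, hdc.symm, hbc.symm, hdb⟩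
      exact ContainsThreeCycles.subset_of_common hdb hdc hbc hcW hg (hsub hp')
        ⟨p, sub3 hp, rfl⟩ ⟨u, sub3 hu, rfl⟩ ⟨v, sub3 hv, rfl⟩ (fun h => hpu ((ρ r).injective h))
        (fun h => hpv ((ρ r).injective h)) (fun h => huv ((ρ r).injective h))
        ⟨y, Set.mem_insert _ _, rfl⟩
  exact hWg x (key ▸ trivial) y (key ▸ trivial) z (key ▸ trivial) hxy hxz hyz

end Growth

section Clean
variable {Y : Type*} {Λ : Type*}

/-- The action of a permutation of `Y` on `Y × Λ` through the first factor. -/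
def amplify (Λ : Type*) : Perm Y →* Perm (Y × Λ) where
  toFun σ := Equiv.prodCongr σ (Equiv.refl Λ)
  map_one' := rfl
  map_mul' _ _ := rfl

@[simp] theorem amplify_apply (σ : Perm Y) (z : Y × Λ) : amplify Λ σ z = (σ z.1, z.2) := rfl

/-- The permutation of `Y × Λ` acting on the fibre over `y` by `β y`. -/
def fiberwise : (Y → Perm Λ) →* Perm (Y × Λ) where
  toFun β := Equiv.prodShear (Equiv.refl Y) β
  map_one' := rfl
  map_mul' _ _ := rfl

@[simp] theorem fiberwise_apply (β : Y → Perm Λ) (z : Y × Λ) :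
    fiberwise β z = (z.1, β z.1 z.2) := rfl

theorem amplify_conj_fiberwise (σ : Perm Y) (β : Y → Perm Λ) :
    amplify Λ σ * fiberwise β * (amplify Λ σ)⁻¹ = fiberwise (fun y => β (σ⁻¹ y)) := by
  rw [mul_inv_eq_iff_eq_mul]
  ext z <;> simp

/-- `f` acts like `f₀` outside of the fibres over `E`. -/
def IsClean (f : Perm (Y × Λ)) (f₀ : Perm Y) (E : Set Y) : Prop :=
  ∀ y, y ∉ E → ∀ l, f (y, l) = (f₀ y, l)

variable {f g : Perm (Y × Λ)} {f₀ g₀ : Perm Y} {E D : Set Y}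

theorem isClean_amplify (σ : Perm Y) (E : Set Y) : IsClean (amplify Λ σ) σ E := fun _ _ _ => rfl

theorem IsClean.eq_amplify (h : IsClean f f₀ ∅) : f = amplify Λ f₀ := by
  ext1 ⟨y, l⟩
  exact h y (by simp) l

theorem IsClean.mono (h : IsClean f f₀ E) (hED : E ⊆ D) : IsClean f f₀ D :=
  fun y hy l => h y (fun hh => hy (hED hh)) l

theorem IsClean.inv (h : IsClean f f₀ E) : IsClean f⁻¹ f₀⁻¹ (f₀ '' E) := by
  intro y hy l
  rw [Perm.inv_eq_iff_eq, h]
  · simp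
  · exact fun hh => hy ⟨_, hh, by simp⟩

theorem IsClean.inv_of_fixed (h : IsClean f f₀ E) (hE : ∀ y ∈ E, f₀ y = y) :
    IsClean f⁻¹ f₀⁻¹ E :=
  h.inv.mono (by rintro _ ⟨y, hy, rfl⟩; rwa [hE y hy])

theorem IsClean.mul (hf : IsClean f f₀ E) (hg : IsClean g g₀ E) (hE : ∀ y, y ∉ E → g₀ y ∉ E) :
    IsClean (f * g) (f₀ * g₀) E := by
  intro y hy l
  rw [Perm.mul_apply, hg y hy, hf _ (hE y hy), Perm.mul_apply]

theorem notMem_of_fixed (hE : ∀ y ∈ E, f₀ y = y) {y : Y} (hy : y ∉ E) : f₀ y ∉ E :=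
  fun h => hy (by have := f₀.injective (hE _ h); rwa [this] at h)

/-- A conjugate `h f h⁻¹` is clean as soon as `f` is trivial over the bad fibres of `h`. -/
theorem IsClean.conj (hf : IsClean f f₀ E) (hg : IsClean g g₀ D) (hfix : ∀ y ∈ D, f₀ y = y)
    (hED : Disjoint E D) : IsClean (g * f * g⁻¹) (g₀ * f₀ * g₀⁻¹) (g₀ '' E) := by
  intro y hy l
  simp only [Perm.mul_apply]
  have hyE : g₀⁻¹ y ∉ E := fun h => hy ⟨_, h, by simp⟩
  by_cases hyD : g₀⁻¹ y ∈ D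
  · have h1 : (g⁻¹ (y, l)).1 ∈ D := by
      by_contra hcon
      have h2 := hg _ hcon (g⁻¹ (y, l)).2
      rw [Prod.mk.eta, ← Perm.mul_apply, mul_inv_cancel, Perm.one_apply] at h2
      have h3 : y = g₀ (g⁻¹ (y, l)).1 := congrArg Prod.fst h2
      rw [h3] at hyD
      exact hcon (by simpa using hyD)
    have h2 := hf _ (hED.symm.notMem_of_mem_left h1) (g⁻¹ (y, l)).2
    rw [hfix _ h1, Prod.mk.eta] at h2
    rw [h2, hfix _ hyD]
    simp
  · have h1 : g⁻¹ (y, l) = (g₀⁻¹ y, l) := by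
      rw [Perm.inv_eq_iff_eq, hg _ hyD]; simp
    rw [h1, hf _ hyE, hg]
    intro h
    have h2 := f₀.injective (hfix _ h)
    rw [h2] at h
    exact hyD h

theorem IsClean.commutator (hf : IsClean f f₀ E) (hg : IsClean g g₀ D)
    (hfE : ∀ y ∈ E, f₀ y = y) (hfD : ∀ y ∈ D, f₀ y = y) (hgE : ∀ y ∈ E, g₀ y = y)
    (hgD : ∀ y ∈ D, g₀ y = y) (hED : Disjoint E D) : ⁅f, g⁆ = amplify Λ ⁅f₀, g₀⁆ := by
  have inv_fix : ∀ {S : Set Y} {k : Perm Y}, (∀ y ∈ S, k y = y) → ∀ y ∈ S, k⁻¹ y = y := by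
    intro S k h y hy
    rw [Perm.inv_eq_iff_eq, h y hy]
  have h1 : IsClean (g * f⁻¹ * g⁻¹) (g₀ * f₀⁻¹ * g₀⁻¹) E :=
    ((hf.inv_of_fixed hfE).conj hg (inv_fix hfD) hED).mono
      (by rintro _ ⟨y, hy, rfl⟩; rwa [hgE y hy])
  have h2 : IsClean (f * g * f⁻¹) (f₀ * g₀ * f₀⁻¹) D :=
    (hg.conj hf hgE hED.symm).mono (by rintro _ ⟨y, hy, rfl⟩; rwa [hfD y hy])
  have h3 : IsClean ⁅f, g⁆ ⁅f₀, g₀⁆ E := by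
    have := hf.mul h1 (fun y hy => notMem_of_fixed (f₀ := g₀ * f₀⁻¹ * g₀⁻¹) (fun y hy => by
      rw [Perm.mul_apply, Perm.mul_apply, inv_fix hgE y hy, inv_fix hfE y hy, hgE y hy]) hy)
    simpa [commutatorElement_def, mul_assoc] using this
  have h4 : IsClean ⁅f, g⁆ ⁅f₀, g₀⁆ D := by
    have := h2.mul (hg.inv_of_fixed hgD) (fun y hy => notMem_of_fixed (inv_fix hgD) hy)
    simpa [commutatorElement_def, mul_assoc] using this
  refine IsClean.eq_amplify fun y _ l => ?_
  by_cases hy : y ∈ E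
  · exact h4 y (hED.notMem_of_mem_left hy) l
  · exact h3 y hy l

end Clean

section SymUnion
variable {Ω : Type u}

/-- An injection between subsets of `A` with equipotent complements in `A` extends to a permutation
supported on `A`. -/
theorem exists_perm_extending {A S : Set Ω} (hS : S ⊆ A) (j : Ω → Ω) (hj : Set.InjOn j S)
    (hjA : Set.MapsTo j S A) (hc : #↥(A \ S) = #↥(A \ (j '' S))) :
    ∃ h : Perm Ω, (∀ z, z ∉ A → h z = z) ∧ ∀ z ∈ S, h z = j z := by
  classical
  let f : ↥(S ∪ Aᶜ) ↪ Ω := ⟨fun z => if (z : Ω) ∈ S then j z else z, by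
    rintro ⟨z, hz⟩ ⟨w, hw⟩ h
    simp only at h
    rw [Subtype.mk.injEq]
    split_ifs at h with h1 h2 h2
    · exact hj h1 h2 h
    · exact absurd (hjA h1) (h ▸ hw.resolve_left h2)
    · exact absurd (hjA h2) (h ▸ hz.resolve_left h1)
    · exact h⟩
  have hfa : ∀ z, f z = if (z : Ω) ∈ S then j z else z := fun _ => rfl
  have h1 : (S ∪ Aᶜ)ᶜ = A \ S := by ext z; simp [and_comm]
  have h2 : (Set.range f)ᶜ = A \ (j '' S) := by
    ext z
    simp only [Set.mem_compl_iff, Set.mem_range, Set.mem_sdiff, Set.mem_image, not_exists, hfa,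
      Subtype.forall]
    constructor
    · intro h
      refine ⟨by_contra fun hz => ?_, ?_⟩
      · have := h z (Or.inr hz)
        rw [if_neg (fun hh => hz (hS hh))] at this
        exact this rfl
      · rintro w ⟨hw, rfl⟩
        have := h w (Or.inl hw)
        rw [if_pos hw] at this
        exact this rfl
    · rintro ⟨hz, h⟩ w hw heq
      split_ifs at heq with hwS
      · exact h w ⟨hwS, heq⟩
      · exact absurd hz (heq ▸ hw.resolve_left hwS)
  obtain ⟨g, hg⟩ := extend_function f (by rw [h1, h2]; exact Cardinal.eq.1 hc)
  refine ⟨g, fun z hz => ?_, fun z hz => ?_⟩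
  · have := hg ⟨z, Or.inr hz⟩
    simpa [hfa, show z ∉ S from fun h => hz (hS h)] using this
  · have := hg ⟨z, Or.inl hz⟩
    simpa [hfa, hz] using this

theorem exists_half {V : Set Ω} (hV : ℵ₀ ≤ #V) : ∃ V' ⊆ V, #V' = #V ∧ #↥(V \ V') = #V := by
  have h : #(V ⊕ V) = #V := by simpa using add_eq_self hV
  obtain ⟨e⟩ := Cardinal.eq.1 h
  refine ⟨Set.range fun v => (e (Sum.inl v) : Ω), ?_, ?_, ?_⟩
  · rintro _ ⟨v, rfl⟩; exact (e _).2
  · exact mk_range_eq _ (fun a b h => Sum.inl_injective (e.injective (Subtype.ext h)))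
  · have : V \ (Set.range fun v => (e (Sum.inl v) : Ω)) =
        Set.range fun v => (e (Sum.inr v) : Ω) := by
      ext z
      constructor
      · rintro ⟨hz, hz'⟩
        obtain ⟨w | w, hw⟩ := e.surjective ⟨z, hz⟩
        · exact absurd ⟨w, by simp [hw]⟩ hz'
        · exact ⟨w, by simp [hw]⟩
      · rintro ⟨w, rfl⟩
        refine ⟨(e _).2, ?_⟩
        rintro ⟨v, hv⟩
        have := e.injective (Subtype.ext hv)
        simp at this
    rw [this]
    exact mk_range_eq _ (fun a b h => Sum.inr_injective (e.injective (Subtype.ext h)))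

/-- If `A ∩ B` is infinite and equipotent to `A ∪ B`, then the permutations supported on `A` or on
`B` generate all permutations supported on `A ∪ B`. -/
theorem mem_of_supported_union {H : Subgroup (Perm Ω)} {A B : Set Ω}
    (hinf : ℵ₀ ≤ #↥(A ∩ B)) (hcard : #↥(A ∪ B) ≤ #↥(A ∩ B))
    (hA : ∀ f : Perm Ω, (∀ z, z ∉ A → f z = z) → f ∈ H)
    (hB : ∀ f : Perm Ω, (∀ z, z ∉ B → f z = z) → f ∈ H)
    (f : Perm Ω) (hf : ∀ z, z ∉ A ∪ B → f z = z) : f ∈ H := by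
  classical
  set κ := #↥(A ∩ B) with hκ
  have squeeze : ∀ V W : Set Ω, V ⊆ W → W ⊆ A ∪ B → #V = κ → #W = κ := fun V W h1 h2 h3 =>
    le_antisymm ((mk_le_mk_of_subset h2).trans hcard) (h3 ▸ mk_le_mk_of_subset h1)
  have cA : #A = κ := squeeze _ _ Set.inter_subset_left Set.subset_union_left rfl
  have cB : #B = κ := squeeze _ _ Set.inter_subset_right Set.subset_union_right rfl
  have main : ∀ f : Perm Ω, (∀ z, z ∉ A ∪ B → f z = z) → #↥(A ∩ f ⁻¹' A) = κ → f ∈ H := by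
    intro f hf hV
    obtain ⟨V', hV', c1, c2⟩ := exists_half (V := A ∩ f ⁻¹' A) (by rw [hV]; exact hinf)
    rw [hV] at c1 c2
    have hSc : #↥(A \ B) ≤ #V' := by
      rw [c1, ← cA]; exact mk_le_mk_of_subset Set.sdiff_subset
    obtain ⟨i⟩ := (Cardinal.le_def _ _).1 hSc
    let j : Ω → Ω := fun z => if h : z ∈ A \ B then i ⟨z, h⟩ else z
    have hj : ∀ z (h : z ∈ A \ B), j z = i ⟨z, h⟩ := fun z h => dif_pos h
    have hjV : ∀ z ∈ A \ B, j z ∈ V' := fun z h => by rw [hj z h]; exact (i _).2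
    have hinj : Set.InjOn j (A \ B) := by
      intro z hz w hw h
      rw [hj z hz, hj w hw] at h
      simpa using i.injective (Subtype.ext h)
    have c3 : #↥(A \ (A \ B)) = κ := by
      rw [Set.sdiff_sdiff_right_self]
    obtain ⟨k, hk, hkS⟩ := exists_perm_extending (A := A) (S := A \ B) Set.sdiff_subset j hinj
      (fun z hz => (hV' (hjV z hz)).1) (by
        rw [c3]
        refine (squeeze _ _ ?_ (Set.sdiff_subset.trans Set.subset_union_left) c2).symm
        rintro z ⟨hz, hz'⟩
        refine ⟨hz.1, ?_⟩
        rintro ⟨w, hw, rfl⟩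
        exact hz' (hjV w hw))
    obtain ⟨l, hl, hlS⟩ := exists_perm_extending (A := A) (S := A \ B) Set.sdiff_subset (f ∘ j)
      (f.injective.comp_injOn hinj) (fun z hz => (hV' (hjV z hz)).2) (by
        rw [c3]
        have : #↥(f '' ((A ∩ f ⁻¹' A) \ V')) = κ := by rw [mk_image_eq f.injective, c2]
        refine (squeeze _ _ ?_ (Set.sdiff_subset.trans Set.subset_union_left) this).symm
        rintro _ ⟨z, ⟨hz, hz'⟩, rfl⟩
        refine ⟨hz.2, ?_⟩
        rintro ⟨w, hw, hw'⟩
        exact hz' (f.injective hw' ▸ hjV w hw))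
    have hm : l⁻¹ * f * k ∈ H := by
      apply hB
      intro z hz
      rw [Perm.mul_apply, Perm.mul_apply, Perm.inv_eq_iff_eq]
      by_cases hzA : z ∈ A
      · rw [hkS z ⟨hzA, hz⟩, hlS z ⟨hzA, hz⟩]; rfl
      · rw [hk z hzA, hl z hzA, hf]
        rintro (h | h) <;> contradiction
    have := H.mul_mem (H.mul_mem (hA l hl) hm) (H.inv_mem (hA k hk))
    simpa [mul_assoc] using this
  by_cases hV : #↥(A ∩ f ⁻¹' A) = κ
  · exact main f hf hV
  have hmaps : ∀ z, z ∈ A ∪ B → f z ∈ A ∪ B := by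
    intro z hz
    by_contra h
    have := f.injective (hf _ h)
    rw [this] at h
    exact h hz
  have hV2 : #↥(A ∩ f ⁻¹' B) = κ := by
    refine le_antisymm (cA ▸ mk_le_mk_of_subset Set.inter_subset_left) ?_
    by_contra hlt
    push Not at hlt
    have hlt' : #↥(A ∩ f ⁻¹' A) < κ :=
      lt_of_le_of_ne (cA ▸ mk_le_mk_of_subset Set.inter_subset_left) hV
    have : A ⊆ (A ∩ f ⁻¹' A) ∪ (A ∩ f ⁻¹' B) := fun z hz =>
      (hmaps z (Or.inl hz)).elim (fun h => Or.inl ⟨hz, h⟩) (fun h => Or.inr ⟨hz, h⟩)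
    have h3 := (mk_le_mk_of_subset this).trans (mk_union_le _ _)
    rw [cA] at h3
    exact absurd h3 (not_le.2 (add_lt_of_lt hinf hlt' hlt))
  obtain ⟨V, hV, c1, c2⟩ := exists_half (V := f '' (A ∩ f ⁻¹' B))
    (by rw [mk_image_eq f.injective, hV2]; exact hinf)
  rw [mk_image_eq f.injective, hV2] at c1 c2
  obtain ⟨W, hW, d1, d2⟩ := exists_half (V := A ∩ B) hinf
  obtain ⟨e⟩ := Cardinal.eq.1 (c1.trans d1.symm)
  let j : Ω → Ω := fun z => if h : z ∈ V then e ⟨z, h⟩ else z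
  have hj : ∀ z (h : z ∈ V), j z = e ⟨z, h⟩ := fun z h => dif_pos h
  have hjV : ∀ z ∈ V, j z ∈ W := fun z h => by rw [hj z h]; exact (e _).2
  have hVB : V ⊆ B := by
    intro z hz
    obtain ⟨w, hw, rfl⟩ := hV hz
    exact hw.2
  obtain ⟨h, hh, hhS⟩ := exists_perm_extending (A := B) (S := V) hVB j
    (by
      intro z hz w hw h
      rw [hj z hz, hj w hw] at h
      simpa using e.injective (Subtype.ext h))
    (fun z hz => (hW (hjV z hz)).2) (by
      rw [squeeze _ (B \ V) ?_ (Set.sdiff_subset.trans Set.subset_union_right) c2,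
        squeeze _ (B \ (j '' V)) ?_ (Set.sdiff_subset.trans Set.subset_union_right) d2]
      · rintro z ⟨hz, hz'⟩
        refine ⟨hz.2, ?_⟩
        rintro ⟨w, hw, rfl⟩
        exact hz' (hjV w hw)
      · rintro z ⟨⟨w, hw, rfl⟩, hz'⟩
        exact ⟨hw.2, hz'⟩)
  have hhB : h ∈ H := hB h hh
  have : h * f ∈ H := by
    refine main _ (fun z hz => ?_) ?_
    · rw [Perm.mul_apply, hf z hz, hh z (fun h => hz (Or.inr h))]
    · have : #↥(f ⁻¹' V) = κ := by rw [mk_preimage_equiv, c1]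
      refine squeeze _ _ ?_ (Set.inter_subset_left.trans Set.subset_union_left) this
      intro z hz
      obtain ⟨w, hw, hw'⟩ := hV hz
      rw [← f.injective hw']
      refine ⟨hw.1, ?_⟩
      rw [Set.mem_preimage, Perm.mul_apply, hw', hhS _ hz]
      exact (hW (hjV _ hz)).1
  have := H.mul_mem (H.inv_mem hhB) this
  simpa using this
end SymUnion

/-- Actions of `Q` and `R` on a set `Y` with a set of ports fixed by `R`, such that every
amplification of the two actions which is modified at the ports only still generates all
amplified three-cycles. -/
structure Gadget (Q R : Type u) [Group Q] [Group R] (Y : Type u) where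
  α : Q →* Perm Y
  ρ : R →* Perm Y
  codePort : Set Y
  ctrlPort : Set Y
  disjoint : Disjoint codePort ctrlPort
  fixed : ∀ r, ∀ y ∈ codePort ∪ ctrlPort, ρ r y = y
  threeCycle_mem : ∀ (Λ : Type u) (ψ : R →* Perm (Y × Λ)),
    (∀ r, IsClean (ψ r) (ρ r) (codePort ∪ ctrlPort)) → ∀ T : Subgroup (Perm (Y × Λ)),
    (∀ q, amplify Λ (α q) ∈ T) → (∀ r, ψ r ∈ T) →
    ∀ a b c, a ≠ b → a ≠ c → b ≠ c → amplify Λ (threeCycle a b c) ∈ T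
  reach : ∀ D : Set Y → Prop, (∀ A B, A ⊆ B → D B → D A) → (∀ A B, D A → D B → D (A ∪ B)) →
    (∀ y, D {y}) → (∀ q A, D A → D (α q '' A)) →
    (∀ r A, D A → Disjoint A (codePort ∪ ctrlPort) → D (ρ r '' A)) → D ctrlPort → D Set.univ
  mk_le : max #Y (max ℵ₀ (max #Q #R)) ≤ #codePort
  ctrlPort_nontrivial : ctrlPort.Nontrivial
  compl_nontrivial : (codePort ∪ ctrlPort)ᶜ.Nontrivial
  moves : ∀ q, q ≠ 1 → ∃ b c c', b ≠ c ∧ b ≠ c' ∧ c ≠ c' ∧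
    α q b ≠ b ∧ α q b ≠ c' ∧ α q c ≠ b ∧ α q c ≠ c'

namespace Gadget
variable {Q R : Type u} [Group Q] [Group R] {Y : Type u} (𝔊 : Gadget Q R Y)
variable {Λ U : Type u} (ι μ : U ↪ Y × Λ)

/-- The subgroups containing the amplified action of `Q`, the amplified three-cycles, permutations
that are clean over `ρ r`, and a permutation carrying `ι` to `μ`. -/
structure IsAdmissible (T : Subgroup (Perm (Y × Λ))) : Prop where
  alpha_mem : ∀ q, amplify Λ (𝔊.α q) ∈ T
  threeCycle_mem : ∀ a b c, a ≠ b → a ≠ c → b ≠ c → amplify Λ (threeCycle a b c) ∈ T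
  rho_mem : ∀ r, ∃ t ∈ T, IsClean t (𝔊.ρ r) (𝔊.codePort ∪ 𝔊.ctrlPort)
  transfer : ∃ t ∈ T, ∀ k, t (ι k) = μ k

/-- `T` normalizes `N`. -/
def Normalizes {P : Type*} [Group P] (T N : Subgroup P) : Prop :=
  ∀ t ∈ T, ∀ n ∈ N, t * n * t⁻¹ ∈ N

/-- The permutations which are forced to lie in `N` by finitely many permutations transported
along `ι`, for all `N` normalized by an admissible subgroup. -/
def controlled : Subgroup (Perm (Y × Λ)) where
  carrier := {f | ∃ F : Set (Perm U), F.Finite ∧ ∀ T, 𝔊.IsAdmissible ι μ T → ∀ N, Normalizes T N →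
    (∀ x ∈ F, Perm.viaEmbedding x ι ∈ N) → f ∈ N}
  one_mem' := ⟨∅, Set.finite_empty, fun _ _ N _ _ => N.one_mem⟩
  mul_mem' := by
    rintro f g ⟨F, hF, hf⟩ ⟨F', hF', hg⟩
    exact ⟨F ∪ F', hF.union hF', fun T hT N hN h =>
      N.mul_mem (hf T hT N hN fun x hx => h x (Or.inl hx))
        (hg T hT N hN fun x hx => h x (Or.inr hx))⟩
  inv_mem' := by
    rintro f ⟨F, hF, hf⟩
    exact ⟨F, hF, fun T hT N hN h => N.inv_mem (hf T hT N hN h)⟩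

/-- All permutations supported over `B` are controlled. -/
def Controls (B : Set Y) : Prop :=
  ∀ f : Perm (Y × Λ), (∀ z, z.1 ∉ B → f z = z) → f ∈ 𝔊.controlled ι μ

variable {𝔊 ι μ}

theorem Controls.mono {A B : Set Y} (hAB : A ⊆ B) (h : 𝔊.Controls ι μ B) : 𝔊.Controls ι μ A :=
  fun f hf => h f fun z hz => hf z fun hz' => hz (hAB hz')

theorem Controls.image {B D : Set Y} (h : 𝔊.Controls ι μ B) (σ : Perm Y) (hBD : Disjoint B D)
    (hσ : ∀ T, 𝔊.IsAdmissible ι μ T → ∃ t ∈ T, IsClean t σ D) : 𝔊.Controls ι μ (σ '' B) := by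
  intro f hf
  obtain ⟨F, hF, hFN⟩ := h ((amplify Λ σ)⁻¹ * f * amplify Λ σ) (by
    intro z hz
    rw [Perm.mul_apply, Perm.mul_apply, Perm.inv_eq_iff_eq, hf]
    rintro ⟨w, hw, hw'⟩
    exact hz (σ.injective hw' ▸ hw))
  refine ⟨F, hF, fun T hT N hN hx => ?_⟩
  obtain ⟨t, ht, htc⟩ := hσ T hT
  have h1 := hN t ht _ (hFN T hT N hN hx)
  have hd : Perm.Disjoint ((amplify Λ σ)⁻¹ * t) ((amplify Λ σ)⁻¹ * f * amplify Λ σ) := by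
    rintro ⟨y, l⟩
    by_cases hy : y ∈ B
    · left
      rw [Perm.mul_apply, Perm.inv_eq_iff_eq, htc y (hBD.notMem_of_mem_left hy)]; rfl
    · right
      rw [Perm.mul_apply, Perm.mul_apply, Perm.inv_eq_iff_eq, hf]
      rintro ⟨w, hw, hw'⟩
      exact hy (σ.injective hw' ▸ hw)
  have h2 := hd.commute.eq
  have h3 : t = amplify Λ σ * ((amplify Λ σ)⁻¹ * t) := by group
  rw [h3, mul_inv_rev, mul_assoc (amplify Λ σ), h2] at h1
  convert h1 using 1
  group

theorem Controls.union_of_inter {A B : Set Y} (hΛ : ℵ₀ ≤ #Λ) (hY : #Y ≤ #Λ)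
    (hA : 𝔊.Controls ι μ A) (hB : 𝔊.Controls ι μ B) (hAB : (A ∩ B).Nonempty) :
    𝔊.Controls ι μ (A ∪ B) := by
  obtain ⟨y, hy⟩ := hAB
  have h1 : #Λ ≤ #↥(Prod.fst ⁻¹' A ∩ Prod.fst ⁻¹' B : Set (Y × Λ)) :=
    mk_le_of_injective (f := fun l => ⟨(y, l), hy⟩) fun a b h =>
      congrArg (fun z => z.1.2) h
  intro f hf
  refine mem_of_supported_union (A := Prod.fst ⁻¹' A) (B := Prod.fst ⁻¹' B) (hΛ.trans h1) ?_
    (fun f hf => hA f hf) (fun f hf => hB f hf) f hf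
  refine (mk_set_le _).trans (le_trans ?_ h1)
  rw [mk_prod, lift_id, lift_id]
  exact (mul_le_mul_left hY _).trans (mul_eq_self hΛ).le

theorem exists_notMem_triple [Infinite Y] (a b c : Y) : ∃ w, w ≠ a ∧ w ≠ b ∧ w ≠ c := by
  classical
  obtain ⟨w, hw⟩ := Infinite.exists_notMem_finset ({a, b, c} : Finset Y)
  simp only [Finset.mem_insert, Finset.mem_singleton, not_or] at hw
  exact ⟨w, hw⟩

theorem infinite (𝔊 : Gadget Q R Y) : Infinite Y :=
  infinite_iff.2 (((le_max_left _ _).trans (le_max_right _ _)).trans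
    (𝔊.mk_le.trans (mk_set_le _)))

/-- Three-cycles act transitively on ordered pairs of distinct points of an infinite set. -/
theorem pair_induction [Infinite Y] {P : Y → Y → Prop}
    (hP : ∀ a b c x y, a ≠ b → a ≠ c → b ≠ c → P x y → P (threeCycle a b c x) (threeCycle a b c y))
    {x y a b : Y} (hxy : x ≠ y) (hab : a ≠ b) (h : P x y) : P a b := by
  have left : ∀ x y z, x ≠ y → z ≠ y → P x y → P z y := by
    intro x y z hxy hzy h
    by_cases hzx : z = x
    · rwa [hzx]
    obtain ⟨w, hwx, hwy, hwz⟩ := exists_notMem_triple x y z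
    have := hP x z w x y (Ne.symm hzx) hwx.symm hwz.symm h
    rwa [threeCycle_apply_first (Ne.symm hzx) hwx.symm,
      threeCycle_apply_of_ne hxy.symm hzy.symm hwy.symm] at this
  have right : ∀ x y z, x ≠ y → x ≠ z → P x y → P x z := by
    intro x y z hxy hxz h
    by_cases hzy : z = y
    · rwa [hzy]
    obtain ⟨w, hwx, hwy, hwz⟩ := exists_notMem_triple x y z
    have := hP y z w x y (Ne.symm hzy) hwy.symm hwz.symm h
    rwa [threeCycle_apply_first (Ne.symm hzy) hwy.symm,
      threeCycle_apply_of_ne hxy hxz hwx.symm] at this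
  obtain ⟨w, hwx, hwa, -⟩ := exists_notMem_triple x a a
  exact right a w b hwa.symm hab (left x w a hwx.symm hwa.symm (right x y w hxy hwx.symm h))

theorem controls_univ (hΛ : ℵ₀ ≤ #Λ) (hY : #Y ≤ #Λ)
    (hμ : Set.range μ = {z : Y × Λ | z.1 ∈ 𝔊.ctrlPort}) : 𝔊.Controls ι μ Set.univ := by
  classical
  have hctrl : 𝔊.Controls ι μ 𝔊.ctrlPort := by
    intro f hf
    have hmaps : ∀ z : Y × Λ, z ∈ Set.range μ ↔ f z ∈ Set.range μ := by
      intro z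
      by_cases hz : z.1 ∈ 𝔊.ctrlPort
      · refine iff_of_true (by rw [hμ]; exact hz) ?_
        rw [hμ]
        by_contra h
        have h' := f.injective (hf _ h)
        rw [h'] at h
        exact h hz
      · rw [hf z hz]
    let x : Perm U := (Equiv.ofInjective μ μ.injective).symm.permCongr
      (f.subtypePerm (p := (· ∈ Set.range μ)) (fun z => (hmaps z).symm))
    have hx : ∀ k, μ (x k) = f (μ k) := by
      intro k
      have : Equiv.ofInjective μ μ.injective (x k) = ⟨f (μ k), (hmaps _).1 ⟨k, rfl⟩⟩ := by
        simp [x, Equiv.permCongr_apply]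
      exact congrArg Subtype.val this
    refine ⟨{x}, Set.finite_singleton _, fun T hT N hN h => ?_⟩
    obtain ⟨t, ht, htm⟩ := hT.transfer
    convert hN t ht _ (h x rfl) using 1
    symm
    rw [mul_inv_eq_iff_eq_mul]
    ext1 z
    rw [Perm.mul_apply, Perm.mul_apply]
    by_cases hz : z ∈ Set.range ι
    · obtain ⟨k, rfl⟩ := hz
      rw [Perm.viaEmbedding_apply, htm, htm, hx]
    · rw [Perm.viaEmbedding_apply_of_notMem _ _ _ hz, hf]
      intro hh
      have : t z ∈ Set.range μ := by rw [hμ]; exact hh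
      obtain ⟨k, hk⟩ := this
      exact hz ⟨k, t.injective (by rw [htm, hk])⟩
  obtain ⟨e, he, e', he', hee⟩ := 𝔊.ctrlPort_nontrivial
  have := 𝔊.infinite
  have hpair : ∀ a b : Y, a ≠ b → 𝔊.Controls ι μ {a, b} := fun a b hab =>
    pair_induction (P := fun a b => 𝔊.Controls ι μ {a, b})
      (fun a b c x y hab hac hbc h => by
        simpa only [Set.image_pair] using h.image (threeCycle a b c) (Set.disjoint_empty _)
          fun T hT => ⟨_, hT.threeCycle_mem a b c hab hac hbc, isClean_amplify _ _⟩)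
      hee hab (hctrl.mono (by rintro _ (rfl | rfl) <;> assumption))
  have hsingle : ∀ y, 𝔊.Controls ι μ {y} := by
    intro y
    obtain ⟨w, hw, -⟩ := exists_notMem_triple y y y
    exact (hpair y w hw.symm).mono (by simp)
  refine 𝔊.reach (𝔊.Controls ι μ) (fun A B => Controls.mono) (fun A B hA hB => ?_) hsingle
    (fun q A hA => ?_) (fun r A hA hd => ?_) hctrl
  · rcases A.eq_empty_or_nonempty with rfl | ⟨a, ha⟩
    · simpa using hB
    rcases B.eq_empty_or_nonempty with rfl | ⟨b, hb⟩
    · simpa using hA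
    by_cases hab : a = b
    · exact hA.union_of_inter hΛ hY hB ⟨a, ha, hab ▸ hb⟩
    · refine ((hA.union_of_inter hΛ hY (hpair a b hab) ⟨a, ha, by simp⟩).union_of_inter hΛ hY hB
        ⟨b, Or.inr (by simp), hb⟩).mono ?_
      exact Set.union_subset_union_left _ Set.subset_union_left
  · exact hA.image _ (Set.disjoint_empty _) fun T hT =>
      ⟨_, hT.alpha_mem q, isClean_amplify _ _⟩
  · exact hA.image _ hd fun T hT => hT.rho_mem r
end Gadget

section Blocks
variable {Y : Type*} {Λ : Type*}

open scoped Classical in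
/-- The permutation `p` on the fibre over `b`. -/
noncomputable def single (b : Y) : Perm Λ →* Perm (Y × Λ) :=
  fiberwise.comp (MonoidHom.mulSingle (fun _ : Y => Perm Λ) b)

@[simp] theorem single_apply_same (b : Y) (p : Perm Λ) (l : Λ) : single b p (b, l) = (b, p l) := by
  simp [single]

theorem single_apply_of_ne {b : Y} (p : Perm Λ) {z : Y × Λ} (h : z.1 ≠ b) : single b p z = z := by
  simp [single, h]

theorem amplify_conj_single (σ : Perm Y) (b : Y) (p : Perm Λ) :
    amplify Λ σ * single b p * (amplify Λ σ)⁻¹ = single (σ b) p := by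
  rw [mul_inv_eq_iff_eq_mul]
  ext1 ⟨y, l⟩
  by_cases h : y = b
  · subst h; simp
  · rw [Perm.mul_apply, Perm.mul_apply, single_apply_of_ne _ h, single_apply_of_ne]
    simpa using h

/-- The permutation acting by `p` over `b` and by `p⁻¹` over `c`. -/
noncomputable def opposed (b c : Y) (p : Perm Λ) : Perm (Y × Λ) := single b p * (single c p)⁻¹

theorem amplify_conj_opposed (σ : Perm Y) (b c : Y) (p : Perm Λ) :
    amplify Λ σ * opposed b c p * (amplify Λ σ)⁻¹ = opposed (σ b) (σ c) p := by
  rw [opposed, opposed, ← amplify_conj_single, ← amplify_conj_single]; group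

theorem opposed_apply_of_ne {b c : Y} (p : Perm Λ) {z : Y × Λ} (hb : z.1 ≠ b) (hc : z.1 ≠ c) :
    opposed b c p z = z := by
  rw [opposed, Perm.mul_apply, ← map_inv, single_apply_of_ne _ hc, single_apply_of_ne _ hb]

theorem opposed_apply_of_fixed {b c : Y} {p : Perm Λ} {z : Y × Λ} (h : p z.2 = z.2) :
    opposed b c p z = z := by
  have key : ∀ (b : Y) (p : Perm Λ), p z.2 = z.2 → single b p z = z := by
    intro b p h
    by_cases hb : z.1 = b
    · obtain ⟨y, l⟩ := z
      simp only at hb h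
      subst hb; rw [single_apply_same, h]
    · exact single_apply_of_ne _ hb
  rw [opposed, Perm.mul_apply, ← map_inv, key c p⁻¹ (by rw [Perm.inv_eq_iff_eq, h]), key b p h]

theorem commutator_opposed {b c c' : Y} (hbc : b ≠ c) (hbc' : b ≠ c') (hcc' : c ≠ c')
    (p q : Perm Λ) : ⁅opposed b c p, opposed b c' q⁆ = single b ⁅p, q⁆ := by
  classical
  have key : ⁅(Pi.mulSingle b p * (Pi.mulSingle c p)⁻¹ : Y → Perm Λ),
      Pi.mulSingle b q * (Pi.mulSingle c' q)⁻¹⁆ =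
        (Pi.mulSingle b ⁅p, q⁆ : Y → Perm Λ) := by
    ext1 y
    simp only [commutatorElement_def, Pi.mul_apply, Pi.inv_apply]
    by_cases h1 : y = b
    · subst h1; simp [hbc, hbc']
    by_cases h2 : y = c
    · subst h2; simp [hbc.symm, hcc']
    · simp [h1, h2]
  have := congrArg (fiberwise (Λ := Λ)) key
  rw [map_commutatorElement] at this
  rw [map_mul, map_mul, map_inv, map_inv] at this
  exact this

/-- If `N` is normalized by two opposed pairs, then `t ∈ N` which separates their supports forces
the commutator of the pairs into `N`. -/
theorem single_commutator_mem {N : Subgroup (Perm (Y × Λ))} {b c c' : Y} (hbc : b ≠ c)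
    (hbc' : b ≠ c') (hcc' : c ≠ c') {p q : Perm Λ}
    (hp : ∀ n ∈ N, opposed b c p * n * (opposed b c p)⁻¹ ∈ N)
    (hq : ∀ n ∈ N, opposed b c' q * n * (opposed b c' q)⁻¹ ∈ N)
    {t : Perm (Y × Λ)} (ht : t ∈ N)
    (hsep : ∀ z : Y × Λ, (z.1 = b ∨ z.1 = c) → p z.2 ≠ z.2 →
      ((t z).1 = b ∨ (t z).1 = c') → q (t z).2 = (t z).2) : single b ⁅p, q⁆ ∈ N := by
  set d := opposed b c p with hd
  set e := opposed b c' q with he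
  have hdis : Perm.Disjoint (t * d⁻¹ * t⁻¹) e := by
    intro z
    by_cases hz : d (t⁻¹ z) = t⁻¹ z
    · left
      rw [Perm.mul_apply, Perm.mul_apply, Perm.inv_eq_iff_eq.2 hz.symm]
      simp
    · right
      have h1 : (t⁻¹ z).1 = b ∨ (t⁻¹ z).1 = c := by
        by_contra h
        push Not at h
        exact hz (opposed_apply_of_ne _ h.1 h.2)
      have h2 : p (t⁻¹ z).2 ≠ (t⁻¹ z).2 := fun h => hz (opposed_apply_of_fixed h)
      have h3 := hsep _ h1 h2
      rw [show t (t⁻¹ z) = z by simp] at h3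
      by_cases h : z.1 = b ∨ z.1 = c'
      · exact opposed_apply_of_fixed (h3 h)
      · push Not at h
        exact opposed_apply_of_ne _ h.1 h.2
  have hcom := hdis.commute.eq
  have h1 : d * t * d⁻¹ * t⁻¹ ∈ N := N.mul_mem (hp t ht) (N.inv_mem ht)
  have h2 := N.mul_mem h1 (hq _ (N.inv_mem h1))
  rw [← commutator_opposed hbc hbc' hcc', commutatorElement_def]
  convert h2 using 1
  have h3 : e * (t * d⁻¹ * t⁻¹)⁻¹ = (t * d⁻¹ * t⁻¹)⁻¹ * e := by
    rw [mul_inv_eq_iff_eq_mul, mul_assoc, ← hcom]; group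
  calc d * e * d⁻¹ * e⁻¹ = d * (t * d⁻¹ * t⁻¹) * ((t * d⁻¹ * t⁻¹)⁻¹ * e) * d⁻¹ * e⁻¹ := by group
    _ = d * (t * d⁻¹ * t⁻¹) * (e * (t * d⁻¹ * t⁻¹)⁻¹) * d⁻¹ * e⁻¹ := by rw [h3]
    _ = _ := by group

end Blocks

section Fibre
variable {G U : Type*} [Group G]

/-- `x` acting on all the levels `n ≥ 0` over `1`. -/
noncomputable def tail (x : Perm U) : Perm (G × (ℤ × U)) :=
  single 1 (fiberwise fun n : ℤ => if 0 ≤ n then x else 1)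

/-- The shift of the levels over `1`. -/
noncomputable def shift : Perm (G × (ℤ × U)) := single 1 (amplify U (Equiv.addRight (1 : ℤ)))

theorem commutator_tail_shift (x : Perm U) :
    ⁅(tail x : Perm (G × (ℤ × U))), (shift : Perm (G × (ℤ × U)))⁆ = single 1 (single 0 x) := by
  rw [tail, shift, ← map_commutatorElement]
  congr 1
  set β : ℤ → Perm U := fun n => if 0 ≤ n then x else 1 with hβ
  have h1 := amplify_conj_fiberwise (Equiv.addRight (1 : ℤ)) β⁻¹
  rw [commutatorElement_def, mul_assoc, mul_assoc, ← map_inv, ← mul_assoc (amplify _ _), h1,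
    ← map_mul]
  simp only [single, MonoidHom.comp_apply]
  congr 1
  ext1 n
  have h2 : (Equiv.addRight (1 : ℤ))⁻¹ n = n - 1 := by
    rw [Perm.inv_eq_iff_eq]; simp
  simp only [Pi.mul_apply, Pi.inv_apply, h2, hβ, MonoidHom.mulSingle_apply]
  rcases lt_trichotomy n 0 with h | rfl | h
  · rw [if_neg (by lia), if_neg (by lia)]; simp [h.ne]
  · simp
  · rw [if_pos (by lia), if_pos (by lia)]; simp [h.ne']

theorem tail_apply_of_ne (x : Perm U) {l : G × (ℤ × U)} (h : l.1 ≠ 1) : tail x l = l :=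
  single_apply_of_ne _ h

theorem shift_apply_of_ne {l : G × (ℤ × U)} (h : l.1 ≠ 1) : shift l = l :=
  single_apply_of_ne _ h

/-- The copy of `U` in the fibre over `b`. -/
def seed {Y : Type*} (b : Y) : U ↪ Y × (G × (ℤ × U)) :=
  ⟨fun k => (b, (1, (0, k))), fun _ _ h => by simpa using h⟩

@[simp] theorem seed_apply {Y : Type*} (b : Y) (k : U) :
    seed (G := G) b k = (b, (1, (0, k))) := rfl

theorem single_eq_viaEmbedding {Y : Type*} (b : Y) (x : Perm U) :
    single b (single 1 (single 0 x)) = Perm.viaEmbedding x (seed (G := G) b) := by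
  ext1 ⟨y, g, n, k⟩
  by_cases h : y = b ∧ g = 1 ∧ n = 0
  · obtain ⟨rfl, rfl, rfl⟩ := h
    have := Perm.viaEmbedding_apply x (seed (G := G) y) k
    rw [seed_apply, seed_apply] at this
    rw [this, single_apply_same, single_apply_same, single_apply_same]
  · rw [Perm.viaEmbedding_apply_of_notMem]
    · by_cases hy : y = b
      · subst hy
        rw [single_apply_same]
        by_cases hg : g = 1
        · subst hg
          rw [single_apply_same, single_apply_of_ne _ (fun hn : n = 0 => h ⟨rfl, rfl, hn⟩)]
        · rw [single_apply_of_ne _ hg]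
      · rw [single_apply_of_ne _ hy]
    · rintro ⟨w, hw⟩
      simp only [seed_apply, Prod.mk.injEq] at hw
      exact h ⟨hw.1.symm, hw.2.1.symm, hw.2.2.1.symm⟩

/-- `G` acting on itself in every fibre. -/
def fibreHom (Y U G : Type*) [Group G] : G →* Perm (Y × (G × (ℤ × U))) :=
  fiberwise.comp ((Pi.constMonoidHom Y (Perm (G × (ℤ × U)))).comp
    ((amplify (ℤ × U)).comp (MulAction.toPermHom G G)))

@[simp] theorem fibreHom_apply {Y : Type*} (g : G) (z : Y × (G × (ℤ × U))) :
    fibreHom Y U G g z = (z.1, (g * z.2.1, z.2.2)) := rfl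

end Fibre

section Halving
variable {Y Z Λ : Type*}

/-- The position of `a` after moving one half of the left summand into the right summand. -/
def evenHalf : Perm (ℕ ⊕ ℕ) :=
  ((sumCongr natSumNatEquivNat.symm (Equiv.refl ℕ)).trans (sumAssoc ℕ ℕ ℕ)).trans
    (sumCongr (Equiv.refl ℕ) natSumNatEquivNat)

/-- As `evenHalf`, for the other half. -/
def oddHalf : Perm (ℕ ⊕ ℕ) :=
  (((sumCongr natSumNatEquivNat.symm (Equiv.refl ℕ)).trans
    (sumCongr (sumComm ℕ ℕ) (Equiv.refl ℕ))).trans (sumAssoc ℕ ℕ ℕ)).trans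
    (sumCongr (Equiv.refl ℕ) natSumNatEquivNat)

/-- The permutation of the ports moving the last index by `π`. -/
noncomputable def movePorts (port : Z × (ℕ ⊕ ℕ) ↪ Y) (π : Perm (ℕ ⊕ ℕ)) : Perm Y :=
  Perm.viaEmbedding (Equiv.prodCongr (Equiv.refl Z) π) port

theorem extend_port_half (port : Z × (ℕ ⊕ ℕ) ↪ Y) (v : Z → Perm Λ) (w : Z × (ℕ ⊕ ℕ) → Perm Λ)
    (hl : ∀ s n, w (s, Sum.inl n) = v s) (hr : ∀ s n, w (s, Sum.inr n) = 1) :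
    (amplify Λ (movePorts port evenHalf))⁻¹ * fiberwise (Function.extend port w 1) *
        amplify Λ (movePorts port evenHalf) *
      ((amplify Λ (movePorts port oddHalf))⁻¹ * fiberwise (Function.extend port w 1) *
        amplify Λ (movePorts port oddHalf)) = fiberwise (Function.extend port w 1) := by
  have conj : ∀ π : Perm (ℕ ⊕ ℕ), (amplify Λ (movePorts port π))⁻¹ *
      fiberwise (Function.extend port w 1) * amplify Λ (movePorts port π) =
      fiberwise (fun y => Function.extend port w 1 (movePorts port π y)) := by
    intro π
    have := amplify_conj_fiberwise (movePorts port π)⁻¹ (Function.extend port w 1)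
    simpa using this
  rw [conj, conj, ← map_mul]
  congr 1
  ext1 y
  rw [Pi.mul_apply]
  by_cases hy : ∃ a, port a = y
  · obtain ⟨⟨s, a⟩, rfl⟩ := hy
    simp only [movePorts, Perm.viaEmbedding_apply, port.injective.extend_apply,
      Equiv.prodCongr_apply, Prod.map_apply, Equiv.refl_apply]
    rcases a with n | n
    · obtain ⟨m | m, hm⟩ : ∃ m, natSumNatEquivNat.symm n = m := ⟨_, rfl⟩
      · simp [evenHalf, oddHalf, hm, hl, hr]
      · simp [evenHalf, oddHalf, hm, hl, hr]
    · simp [evenHalf, oddHalf, hr]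
  · simp only [movePorts]
    rw [Perm.viaEmbedding_apply_of_notMem _ _ _ hy, Perm.viaEmbedding_apply_of_notMem _ _ _ hy,
      Function.extend_apply' _ _ _ hy]
    simp

end Halving

/-- A choice of ports for the construction: for each `r : R`, a port carrying a link and a family
of ports for codes, and a bijection `μ` from `Y` onto the fibres over the control ports. -/
structure Layout {Q R Y : Type u} [Group Q] [Group R] (𝔊 : Gadget Q R Y) (G : Type u) where
  port : R × Option (Y × (ℕ ⊕ ℕ)) ↪ Y
  port_mem : ∀ a, port a ∈ 𝔊.codePort
  μ : Y ↪ Y × (G × (ℤ × Y))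
  range_μ : Set.range μ = {z | z.1 ∈ 𝔊.ctrlPort}
  r₁ : R
  r₁_ne_one : r₁ ≠ 1

namespace Layout
variable {Q R Y : Type u} [Group Q] [Group R] {𝔊 : Gadget Q R Y} {G : Type u}
  (L : Layout 𝔊 G)

/-- The ports for codes. -/
def codePort : (R × Y) × (ℕ ⊕ ℕ) ↪ Y :=
  ⟨fun a => L.port (a.1.1, some (a.1.2, a.2)), fun a b h => by
    simpa [Prod.ext_iff, and_assoc] using L.port.injective h⟩

theorem μ_fst_mem (k : Y) : (L.μ k).1 ∈ 𝔊.ctrlPort := by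
  have : L.μ k ∈ Set.range L.μ := ⟨k, rfl⟩
  rwa [L.range_μ] at this

theorem μ_fst_ne (k : Y) (a) : (L.μ k).1 ≠ L.port a := fun h =>
  (Set.disjoint_left.1 𝔊.disjoint) (L.port_mem a) (h ▸ L.μ_fst_mem k)

theorem amplify_ρ_apply (r : R) {z : Y × (G × (ℤ × Y))}
    (hz : z.1 ∈ 𝔊.codePort ∪ 𝔊.ctrlPort) : amplify _ (𝔊.ρ r) z = z := by
  rw [amplify_apply, 𝔊.fixed r _ hz]

variable [Group G]

/-- The source of the link. -/
def source : Y ↪ Y × (G × (ℤ × Y)) := seed (L.port (1, none))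

open scoped Classical in
/-- The points over the ports moved by `R`, as a free `R`-set. -/
noncomputable def portMap : R × (((Y × (ℕ ⊕ ℕ)) × (G × (ℤ × Y))) ⊕ Y) → Y × (G × (ℤ × Y))
  | (s, .inl (a, l)) => (L.port (s, some a), l)
  | (s, .inr k) => if s = L.r₁ then L.μ k else seed (L.port (s, none)) k

theorem portMap_mem (a) : (L.portMap a).1 ∈ 𝔊.codePort ∪ 𝔊.ctrlPort := by
  rcases a with ⟨s, ⟨a, l⟩ | k⟩
  · exact Or.inl (L.port_mem _)
  · by_cases h : s = L.r₁
    · simp only [portMap, h, if_true]; exact Or.inr (L.μ_fst_mem k)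
    · simp only [portMap, h, if_false]; exact Or.inl (L.port_mem _)

theorem portMap_injective : Function.Injective L.portMap := by
  rintro ⟨s, ⟨a, l⟩ | k⟩ ⟨s', ⟨a', l'⟩ | k'⟩ h
  · have h1 := L.port.injective (congrArg Prod.fst h)
    have h2 : l = l' := congrArg Prod.snd h
    simp only [Prod.mk.injEq, Option.some.injEq] at h1
    rw [h1.1, h1.2, h2]
  · by_cases hs : s' = L.r₁
    · simp only [portMap, hs, if_true] at h
      exact absurd (congrArg Prod.fst h).symm (L.μ_fst_ne _ _)
    · simp only [portMap, hs, if_false] at h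
      simpa using L.port.injective (congrArg Prod.fst h)
  · by_cases hs : s = L.r₁
    · simp only [portMap, hs, if_true] at h
      exact absurd (congrArg Prod.fst h) (L.μ_fst_ne _ _)
    · simp only [portMap, hs, if_false] at h
      simpa using L.port.injective (congrArg Prod.fst h)
  · by_cases hs : s = L.r₁ <;> by_cases hs' : s' = L.r₁
    · simp only [portMap, hs, hs', if_true] at h
      rw [hs, hs', L.μ.injective h]
    · simp only [portMap, hs, hs', if_true, if_false] at h
      exact absurd (congrArg Prod.fst h) (L.μ_fst_ne _ _)
    · simp only [portMap, hs, hs', if_true, if_false] at h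
      exact absurd (congrArg Prod.fst h).symm (L.μ_fst_ne _ _)
    · simp only [portMap, hs, hs', if_false] at h
      have h1 := L.port.injective (congrArg Prod.fst h)
      have h2 : k = k' := by simpa using congrArg (fun z => z.2.2.2) h
      simp only [Prod.mk.injEq, and_true] at h1
      rw [h1, h2]

/-- The free action of `R` over the ports. -/
noncomputable def portHom : R →* Perm (Y × (G × (ℤ × Y))) :=
  (Perm.viaEmbeddingHom ⟨L.portMap, L.portMap_injective⟩).comp
    ((amplify _).comp (MulAction.toPermHom R R))

theorem portHom_portMap (r s : R) (z) : L.portHom r (L.portMap (s, z)) = L.portMap (r * s, z) :=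
  Perm.viaEmbedding_apply _ (⟨L.portMap, L.portMap_injective⟩ : _ ↪ _) (s, z)

theorem portHom_apply_of_notMem (r : R) {z : Y × (G × (ℤ × Y))}
    (hz : z.1 ∉ 𝔊.codePort ∪ 𝔊.ctrlPort) : L.portHom r z = z :=
  Perm.viaEmbedding_apply_of_notMem _ _ _ fun ⟨a, ha⟩ => hz (ha ▸ L.portMap_mem a)

theorem disjoint_portHom (r s : R) : Perm.Disjoint (L.portHom r) (amplify _ (𝔊.ρ s)) := by
  intro z
  by_cases hz : z.1 ∈ 𝔊.codePort ∪ 𝔊.ctrlPort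
  · exact Or.inr (amplify_ρ_apply s hz)
  · exact Or.inl (L.portHom_apply_of_notMem r hz)

/-- The action of `R` which is free over the ports. -/
noncomputable def baseHom : R →* Perm (Y × (G × (ℤ × Y))) where
  toFun r := L.portHom r * amplify _ (𝔊.ρ r)
  map_one' := by simp
  map_mul' r s := by
    rw [map_mul, map_mul, map_mul, mul_assoc, mul_assoc, ← mul_assoc (L.portHom s),
      (L.disjoint_portHom s r).commute.eq, mul_assoc]

theorem baseHom_apply (r : R) : L.baseHom r = L.portHom r * amplify _ (𝔊.ρ r) := rfl

theorem isClean_baseHom (r : R) :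
    IsClean (L.baseHom r) (𝔊.ρ r) (𝔊.codePort ∪ 𝔊.ctrlPort) := by
  intro y hy l
  rw [baseHom_apply, Perm.mul_apply, L.portHom_apply_of_notMem]
  · rfl
  · exact notMem_of_fixed (𝔊.fixed r) hy

theorem baseHom_portMap (r s : R) (z) : L.baseHom r (L.portMap (s, z)) = L.portMap (r * s, z) := by
  rw [baseHom_apply, Perm.mul_apply, amplify_ρ_apply _ (L.portMap_mem _), portHom_portMap]

theorem baseHom_codePort (r s : R) (u : Y) (a : ℕ ⊕ ℕ) (l : G × (ℤ × Y)) :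
    L.baseHom r (L.codePort ((s, u), a), l) = (L.codePort ((r * s, u), a), l) :=
  L.baseHom_portMap r s (.inl ((u, a), l))

theorem baseHom_source (k : Y) : L.baseHom L.r₁ (L.source k) = L.μ k := by
  change L.baseHom L.r₁ (seed (L.port (1, none)) k) = L.μ k
  have := L.baseHom_portMap L.r₁ 1 (.inr k)
  simpa only [portMap, mul_one, if_true, if_neg L.r₁_ne_one.symm] using this

theorem source_ne_codePort (k : Y) (a) : (L.source k).1 ≠ L.codePort a := by
  intro h
  simpa using L.port.injective h

end Layout

theorem conj_amplify_threeCycle {Y Λ : Type*} (f : Perm (Y × Λ)) {a b c a' b' c' : Y}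
    (hab : a ≠ b) (hac : a ≠ c) (hbc : b ≠ c) (hab' : a' ≠ b') (hac' : a' ≠ c') (hbc' : b' ≠ c')
    (ha : ∀ l, f (a, l) = (a', l)) (hb : ∀ l, f (b, l) = (b', l)) (hc : ∀ l, f (c, l) = (c', l)) :
    f * amplify Λ (threeCycle a b c) * f⁻¹ = amplify Λ (threeCycle a' b' c') := by
  rw [mul_inv_eq_iff_eq_mul]
  ext1 ⟨y, l⟩
  simp only [Perm.mul_apply, amplify_apply]
  by_cases h1 : y = a
  · subst h1
    rw [threeCycle_apply_first hab hac, ha, hb, threeCycle_apply_first hab' hac']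
  by_cases h2 : y = b
  · subst h2
    rw [threeCycle_apply_second a y c hac hbc, hb, hc, threeCycle_apply_second a' b' c' hac' hbc']
  by_cases h3 : y = c
  · subst h3
    rw [threeCycle_apply_third, ha, hc, threeCycle_apply_third]
  · have key : ∀ x x', y ≠ x → (∀ l, f (x, l) = (x', l)) → (f (y, l)).1 ≠ x' := by
      intro x x' hx hf h
      have : f (x, (f (y, l)).2) = f (y, l) := by rw [hf, ← h]
      exact hx (congrArg Prod.fst (f.injective this)).symm
    rw [threeCycle_apply_of_ne h1 h2 h3,
      threeCycle_apply_of_ne (key _ _ h1 ha) (key _ _ h2 hb) (key _ _ h3 hc)]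

namespace Layout
variable {Q R Y : Type u} [Group Q] [Group R] {𝔊 : Gadget Q R Y} {G : Type u}
  (L : Layout 𝔊 G)

variable (p : Y → Perm (G × (ℤ × Y)))

open scoped Classical in
/-- The codes at the ports. -/
noncomputable def code : (R × Y) × (ℕ ⊕ ℕ) → Perm (G × (ℤ × Y))
  | ((s, u), .inl _) => if s = L.r₁ then p u else 1
  | (_, .inr _) => 1

/-- The codes extended to `Y`. -/
noncomputable def codeFun : Y → Perm (G × (ℤ × Y)) := Function.extend L.codePort (L.code p) 1

theorem codeFun_of_notMem {y : Y} (hy : y ∉ 𝔊.codePort ∪ 𝔊.ctrlPort) : L.codeFun p y = 1 :=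
  Function.extend_apply' _ _ _ fun ⟨_, ha⟩ => hy (Or.inl (ha ▸ L.port_mem _))

theorem codeFun_codePort (a) : L.codeFun p (L.codePort a) = L.code p a :=
  L.codePort.injective.extend_apply _ _ _

variable [Group G]

theorem baseHom_conj_fiberwise (r : R) (w : (R × Y) × (ℕ ⊕ ℕ) → Perm (G × (ℤ × Y))) :
    L.baseHom r * fiberwise (Function.extend L.codePort w 1) * (L.baseHom r)⁻¹ =
      fiberwise (Function.extend L.codePort (fun a => w ((r⁻¹ * a.1.1, a.1.2), a.2)) 1) := by
  rw [mul_inv_eq_iff_eq_mul]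
  ext1 z
  simp only [Perm.mul_apply, fiberwise_apply]
  by_cases hz : ∃ a, L.codePort a = z.1
  · obtain ⟨⟨⟨s, u⟩, a⟩, ha⟩ := hz
    obtain ⟨y, l⟩ := z
    simp only at ha
    subst ha
    rw [L.codePort.injective.extend_apply, baseHom_codePort, baseHom_codePort]
    simp only
    rw [L.codePort.injective.extend_apply]
    simp
  · rw [Function.extend_apply' _ _ _ hz, Function.extend_apply']
    · simp
    · rintro ⟨⟨⟨s, u⟩, a⟩, ha⟩
      refine hz ⟨((r⁻¹ * s, u), a), ?_⟩
      have : L.baseHom r (L.codePort ((r⁻¹ * s, u), a), (L.baseHom r z).2) = L.baseHom r z := by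
        rw [baseHom_codePort, mul_inv_cancel_left, ha]
      exact congrArg Prod.fst ((L.baseHom r).injective this)

/-- The free action over the ports conjugated by the codes. -/
noncomputable def codeHom : R →* Perm (Y × (G × (ℤ × Y))) :=
  (MulAut.conj (fiberwise (L.codeFun p))).toMonoidHom.comp L.baseHom

theorem codeHom_apply (r : R) : L.codeHom p r =
    fiberwise (L.codeFun p) * L.baseHom r * (fiberwise (L.codeFun p))⁻¹ := rfl

theorem codeHom_mul_inv (r : R) : L.codeHom p r * (L.baseHom r)⁻¹ =
    fiberwise (Function.extend L.codePort
      (fun a => L.code p a * (L.code p ((r⁻¹ * a.1.1, a.1.2), a.2))⁻¹) 1) := by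
  have h1 : L.codeHom p r * (L.baseHom r)⁻¹ = fiberwise (L.codeFun p) *
      (L.baseHom r * fiberwise (L.codeFun p) * (L.baseHom r)⁻¹)⁻¹ := by
    rw [codeHom_apply]; group
  rw [h1, codeFun, baseHom_conj_fiberwise, ← map_inv, ← map_mul]
  congr 1
  ext1 y
  rw [Pi.mul_apply, Pi.inv_apply]
  by_cases hy : ∃ a, L.codePort a = y
  · obtain ⟨a, rfl⟩ := hy
    simp only [L.codePort.injective.extend_apply]
  · simp only [Function.extend_apply' _ _ _ hy]
    simp

theorem isClean_codeHom (r : R) :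
    IsClean (L.codeHom p r) (𝔊.ρ r) (𝔊.codePort ∪ 𝔊.ctrlPort) := by
  intro y hy l
  have h1 : (fiberwise (L.codeFun p))⁻¹ (y, l) = (y, l) := by
    rw [Perm.inv_eq_iff_eq, fiberwise_apply, codeFun_of_notMem _ _ hy]; rfl
  rw [codeHom_apply, Perm.mul_apply, Perm.mul_apply, h1, L.isClean_baseHom r y hy, fiberwise_apply,
    codeFun_of_notMem _ _ (notMem_of_fixed (𝔊.fixed r) hy)]
  rfl

theorem codeHom_of_code_eq_one {r s : R} {u : Y} {a : ℕ ⊕ ℕ} (h : L.code p ((s, u), a) = 1)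
    (h' : L.code p ((r * s, u), a) = 1) (l : G × (ℤ × Y)) :
    L.codeHom p r (L.codePort ((s, u), a), l) = (L.codePort ((r * s, u), a), l) := by
  have h1 : (fiberwise (L.codeFun p))⁻¹ (L.codePort ((s, u), a), l) =
      (L.codePort ((s, u), a), l) := by
    rw [Perm.inv_eq_iff_eq, fiberwise_apply, codeFun_codePort, h]; rfl
  rw [codeHom_apply, Perm.mul_apply, Perm.mul_apply, h1, baseHom_codePort, fiberwise_apply,
    codeFun_codePort, h']
  rfl

theorem codeHom_source (k : Y) : L.codeHom p L.r₁ (L.source k) = L.μ k := by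
  have key : ∀ z : Y × (G × (ℤ × Y)), (∀ a, z.1 ≠ L.codePort a) →
      fiberwise (L.codeFun p) z = z := by
    intro z hz
    rw [fiberwise_apply, codeFun, Function.extend_apply' _ _ _ fun ⟨a, ha⟩ => hz a ha.symm]; rfl
  rw [codeHom_apply, Perm.mul_apply, Perm.mul_apply,
    Perm.inv_eq_iff_eq.2 (key _ (L.source_ne_codePort k)).symm, baseHom_source,
    key _ fun a => L.μ_fst_ne _ _]

/-- The group generated by `Q` and `R`. -/
noncomputable def group : Subgroup (Perm (Y × (G × (ℤ × Y)))) :=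
  Subgroup.closure (Set.range (fun q => amplify (G × (ℤ × Y)) (𝔊.α q)) ∪
    Set.range (L.codeHom p))

theorem amplify_α_mem (q : Q) : amplify (G × (ℤ × Y)) (𝔊.α q) ∈ L.group p :=
  Subgroup.subset_closure (Or.inl ⟨q, rfl⟩)

theorem codeHom_mem (r : R) : L.codeHom p r ∈ L.group p :=
  Subgroup.subset_closure (Or.inr ⟨r, rfl⟩)

theorem threeCycle_mem (a b c : Y) (hab : a ≠ b) (hac : a ≠ c) (hbc : b ≠ c) :
    amplify (G × (ℤ × Y)) (threeCycle a b c) ∈ L.group p :=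
  𝔊.threeCycle_mem _ (L.codeHom p) (L.isClean_codeHom p) _ (L.amplify_α_mem p) (L.codeHom_mem p)
    a b c hab hac hbc

theorem isAdmissible : 𝔊.IsAdmissible L.source L.μ (L.group p) where
  alpha_mem := L.amplify_α_mem p
  threeCycle_mem := L.threeCycle_mem p
  rho_mem r := ⟨_, L.codeHom_mem p r, L.isClean_codeHom p r⟩
  transfer := ⟨_, L.codeHom_mem p L.r₁, L.codeHom_source p⟩

theorem opposed_mem {b c : Y} (hbc : b ≠ c) (u : Y) : opposed b c (p u) ∈ L.group p := by
  obtain ⟨y, hy, y', hy', hyy⟩ := 𝔊.compl_nontrivial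
  have hy1 := notMem_of_fixed (𝔊.fixed L.r₁) hy
  have hy1' := notMem_of_fixed (𝔊.fixed L.r₁) hy'
  have port_ne : ∀ a z, z ∉ 𝔊.codePort ∪ 𝔊.ctrlPort → L.codePort a ≠ z :=
    fun a z hz h => hz (h ▸ Or.inl (L.port_mem _))
  set e := L.codePort ((1, u), Sum.inl 0) with he
  set e' := L.codePort ((L.r₁, u), Sum.inl 0) with he'
  have h0 : ∀ l, L.codeHom p L.r₁ (e, l) = (e', p u l) := by
    intro l
    have h1 : (fiberwise (L.codeFun p))⁻¹ (e, l) = (e, l) := by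
      rw [Perm.inv_eq_iff_eq, fiberwise_apply, he, codeFun_codePort]
      simp [code, L.r₁_ne_one.symm]
    rw [codeHom_apply, Perm.mul_apply, Perm.mul_apply, h1, he, baseHom_codePort, fiberwise_apply,
      codeFun_codePort]
    simp [code, he']
  have hσ := L.threeCycle_mem p e y y' (port_ne _ _ hy) (port_ne _ _ hy') hyy
  have hσ' := L.threeCycle_mem p e' (𝔊.ρ L.r₁ y) (𝔊.ρ L.r₁ y') (port_ne _ _ hy1)
    (port_ne _ _ hy1') ((𝔊.ρ L.r₁).injective.ne hyy)
  have h2 := conj_amplify_threeCycle ((single e' (p u))⁻¹ * L.codeHom p L.r₁) (a := e) (a' := e')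
    (port_ne _ _ hy) (port_ne _ _ hy') hyy (port_ne _ _ hy1)
    (port_ne _ _ hy1') ((𝔊.ρ L.r₁).injective.ne hyy)
    (fun l => by rw [Perm.mul_apply, h0, Perm.inv_eq_iff_eq, single_apply_same])
    (fun l => by
      rw [Perm.mul_apply, L.isClean_codeHom p L.r₁ y hy, Perm.inv_eq_iff_eq,
        single_apply_of_ne _ (port_ne _ _ hy1).symm])
    (fun l => by
      rw [Perm.mul_apply, L.isClean_codeHom p L.r₁ y' hy', Perm.inv_eq_iff_eq,
        single_apply_of_ne _ (port_ne _ _ hy1').symm])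
  have h3 := (L.group p).mul_mem ((L.group p).mul_mem ((L.group p).mul_mem
    (L.codeHom_mem p L.r₁) hσ) ((L.group p).inv_mem (L.codeHom_mem p L.r₁)))
    ((L.group p).inv_mem hσ')
  have h4 := amplify_conj_single (threeCycle e' (𝔊.ρ L.r₁ y) (𝔊.ρ L.r₁ y')) e' (p u)
  rw [threeCycle_apply_first (port_ne _ _ hy1) (port_ne _ _ hy1')] at h4
  have h5 : opposed e' (𝔊.ρ L.r₁ y) (p u) ∈ L.group p := by
    convert h3 using 1
    rw [opposed, ← h4, ← h2]
    group
  have := 𝔊.infinite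
  refine Gadget.pair_induction (P := fun b c => opposed b c (p u) ∈ L.group p)
    (fun a b c x z hab hac hbc h => ?_) (port_ne _ _ hy1) hbc h5
  rw [← amplify_conj_opposed]
  exact (L.group p).mul_mem ((L.group p).mul_mem (L.threeCycle_mem p a b c hab hac hbc) h)
    ((L.group p).inv_mem (L.threeCycle_mem p a b c hab hac hbc))

/-- The permutations which are to be forced into all nontrivial normal subgroups. -/
noncomputable def generator : G ⊕ Q ⊕ R ⊕ Bool → Perm (Y × (G × (ℤ × Y)))
  | .inl g => fibreHom Y Y G g
  | .inr (.inl q) => amplify _ (𝔊.α q)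
  | .inr (.inr (.inl r)) => L.baseHom r
  | .inr (.inr (.inr i)) => amplify _ (movePorts L.codePort (cond i evenHalf oddHalf))

end Layout

namespace Layout
variable {Q R Y : Type u} [Group Q] [Group R] {𝔊 : Gadget Q R Y} {G : Type u} [Group G]
  (L : Layout 𝔊 G) (p : Y → Perm (G × (ℤ × Y)))

/-- The codes suffice to produce the permutations controlling the generators. -/
def IsCoded : Prop :=
  (∃ u, p u = shift) ∧ ∀ i, ∃ F : Set (Perm Y), (∀ x ∈ F, ∃ u, p u = tail x) ∧
    ∀ N, Gadget.Normalizes (L.group p) N → (∀ x ∈ F, Perm.viaEmbedding x L.source ∈ N) →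
      L.generator i ∈ N

variable {L p}

theorem generator_mem (hp : L.IsCoded p) {N : Subgroup (Perm (Y × (G × (ℤ × Y))))}
    (hN : Gadget.Normalizes (L.group p) N) {t : Perm (Y × (G × (ℤ × Y)))} (ht : t ∈ N)
    {b c c' : Y} (hbc : b ≠ c) (hbc' : b ≠ c') (hcc' : c ≠ c')
    (hsep : ∀ z, (z.1 = b ∨ z.1 = c) → z.2.1 = 1 → ((t z).1 = b ∨ (t z).1 = c') →
      (t z).2.1 ≠ 1) (i) : L.generator i ∈ N := by
  obtain ⟨⟨u, hu⟩, hp⟩ := hp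
  obtain ⟨F, hF, hFN⟩ := hp i
  refine hFN N hN fun x hx => ?_
  obtain ⟨v, hv⟩ := hF x hx
  have h1 : single b ⁅(tail x : Perm (G × (ℤ × Y))), (shift : Perm (G × (ℤ × Y)))⁆ ∈ N := by
    refine single_commutator_mem hbc hbc' hcc' ?_ ?_ ht ?_
    · rw [← hv]; exact hN _ (L.opposed_mem p hbc v)
    · rw [← hu]; exact hN _ (L.opposed_mem p hbc' u)
    · intro z hz hxz hz'
      refine shift_apply_of_ne (hsep z hz ?_ hz')
      by_contra h
      exact hxz (tail_apply_of_ne x h)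
  rw [commutator_tail_shift] at h1
  rw [source, ← single_eq_viaEmbedding]
  by_cases hb : b = L.port (1, none)
  · rwa [← hb]
  · have := 𝔊.infinite
    obtain ⟨w, hw, hw', -⟩ := Gadget.exists_notMem_triple b (L.port (1, none)) b
    have h2 := hN _ (L.threeCycle_mem p _ _ _ hb hw.symm hw'.symm) _ h1
    rwa [amplify_conj_single, threeCycle_apply_first hb hw.symm] at h2

open scoped Classical in
theorem group_le (hp : L.IsCoded p) {N : Subgroup (Perm (Y × (G × (ℤ × Y))))}
    (hN : Gadget.Normalizes (L.group p) N) {t : Perm (Y × (G × (ℤ × Y)))} (ht : t ∈ N)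
    {b c c' : Y} (hbc : b ≠ c) (hbc' : b ≠ c') (hcc' : c ≠ c')
    (hsep : ∀ z, (z.1 = b ∨ z.1 = c) → z.2.1 = 1 → ((t z).1 = b ∨ (t z).1 = c') →
      (t z).2.1 ≠ 1) : L.group p ≤ N := by
  have hgen := generator_mem hp hN ht hbc hbc' hcc' hsep
  rw [group, Subgroup.closure_le]
  rintro _ (⟨q, rfl⟩ | ⟨r, rfl⟩)
  · exact hgen (.inr (.inl q))
  have hr := hgen (.inr (.inr (.inl r)))
  have he := hgen (.inr (.inr (.inr true)))
  have ho := hgen (.inr (.inr (.inr false)))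
  simp only [generator, cond_true, cond_false] at hr he ho
  set x := L.codeHom p r * (L.baseHom r)⁻¹ with hx
  have hxr : x * L.baseHom r = L.codeHom p r := by rw [hx]; group
  have hmem : ∀ n ∈ N, n⁻¹ * (x * n * x⁻¹) ∈ N := by
    intro n hn
    have h1 := hN _ (L.codeHom_mem p r) _ (N.mul_mem (N.mul_mem (N.inv_mem hr) hn) hr)
    refine N.mul_mem (N.inv_mem hn) ?_
    convert h1 using 1
    rw [hx]; group
  have hfactor : (amplify _ (movePorts L.codePort evenHalf))⁻¹ * x *
      amplify _ (movePorts L.codePort evenHalf) *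
      ((amplify _ (movePorts L.codePort oddHalf))⁻¹ * x *
      amplify _ (movePorts L.codePort oddHalf)) = x := by
    rw [hx, codeHom_mul_inv]
    refine extend_port_half L.codePort
      (fun s => (if s.1 = L.r₁ then p s.2 else 1) * (if r⁻¹ * s.1 = L.r₁ then p s.2 else 1)⁻¹) _
      (fun s n => rfl) (fun s n => ?_)
    simp [code]
  rw [SetLike.mem_coe, ← hxr]
  refine N.mul_mem ?_ hr
  set n₁ := (amplify (G × (ℤ × Y)) (movePorts L.codePort evenHalf))
  set n₂ := (amplify (G × (ℤ × Y)) (movePorts L.codePort oddHalf))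
  have h1 := hmem n₁ he
  have h2 := hmem n₂ ho
  have h3 : x = (n₁⁻¹ * (x * n₁ * x⁻¹))⁻¹ * (n₂⁻¹ * (x * n₂ * x⁻¹))⁻¹ := by
    calc x = (n₁⁻¹ * (x * n₁ * x⁻¹))⁻¹ * (n₁⁻¹ * x * n₁ * (n₂⁻¹ * x * n₂)) *
          (n₂⁻¹ * x * n₂)⁻¹ * (n₂⁻¹ * x * n₂) * x⁻¹ * x * (n₂⁻¹ * x * n₂)⁻¹ := by group
      _ = _ := by rw [hfactor]; group
  rw [h3]
  exact N.mul_mem (N.inv_mem h1) (N.inv_mem h2)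

theorem exists_three (Y : Type*) [Infinite Y] : ∃ b c c' : Y, b ≠ c ∧ b ≠ c' ∧ c ≠ c' := by
  obtain ⟨b⟩ := (inferInstance : Nonempty Y)
  obtain ⟨c, hc, -⟩ := Gadget.exists_notMem_triple b b b
  obtain ⟨c', hb, hc', -⟩ := Gadget.exists_notMem_triple b c c
  exact ⟨b, c, c', hc.symm, hb.symm, hc'.symm⟩

theorem group_le_of_fibreHom_mem (hp : L.IsCoded p) {N : Subgroup (Perm (Y × (G × (ℤ × Y))))}
    (hN : Gadget.Normalizes (L.group p) N) {g : G} (hg : g ≠ 1) (h : fibreHom Y Y G g ∈ N) :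
    L.group p ≤ N := by
  have := 𝔊.infinite
  obtain ⟨b, c, c', hbc, hbc', hcc'⟩ := exists_three Y
  refine group_le hp hN h hbc hbc' hcc' fun z _ hz _ => ?_
  rw [fibreHom_apply]
  simpa [hz] using hg

theorem group_le_of_amplify_mem (hp : L.IsCoded p) {N : Subgroup (Perm (Y × (G × (ℤ × Y))))}
    (hN : Gadget.Normalizes (L.group p) N) {q : Q} (hq : q ≠ 1)
    (h : amplify (G × (ℤ × Y)) (𝔊.α q) ∈ N) : L.group p ≤ N := by
  obtain ⟨b, c, c', hbc, hbc', hcc', h1, h2, h3, h4⟩ := 𝔊.moves q hq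
  refine group_le hp hN h hbc hbc' hcc' fun z hz _ hz' => ?_
  rw [amplify_apply] at hz'
  rcases hz with hz | hz <;> rw [hz] at hz' <;> tauto

theorem group_le_of_codeHom_mem (hp : L.IsCoded p) {N : Subgroup (Perm (Y × (G × (ℤ × Y))))}
    (hN : Gadget.Normalizes (L.group p) N) {r : R} (hr : r ≠ 1) (h : L.codeHom p r ∈ N) :
    L.group p ≤ N := by
  have := 𝔊.infinite
  obtain ⟨u⟩ := (inferInstance : Nonempty Y)
  refine group_le hp hN h (b := L.codePort ((1, u), .inr 0)) (c := L.codePort ((1, u), .inr 1))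
    (c' := L.codePort ((1, u), .inr 2)) (by simp) (by simp) (by simp) ?_
  rintro ⟨y, l⟩ hz - hz'
  rcases hz with hz | hz <;> simp only at hz <;> subst hz <;>
    rw [L.codeHom_of_code_eq_one p rfl rfl] at hz' <;> simp [hr] at hz'

theorem fibreHom_mem [Nontrivial R] (hp : L.IsCoded p) (g : G) :
    fibreHom Y Y G g ∈ L.group p := by
  have := 𝔊.infinite
  obtain ⟨u⟩ := (inferInstance : Nonempty Y)
  refine generator_mem hp (fun t ht n hn => mul_mem (mul_mem ht hn) (inv_mem ht))
    (L.codeHom_mem p L.r₁) (b := L.codePort ((1, u), .inr 0)) (c := L.codePort ((1, u), .inr 1))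
    (c' := L.codePort ((1, u), .inr 2)) (by simp) (by simp) (by simp) ?_ (.inl g)
  rintro ⟨y, l⟩ hz - hz'
  rcases hz with hz | hz <;> simp only at hz <;> subst hz <;>
    rw [L.codeHom_of_code_eq_one p rfl rfl] at hz' <;> simp [L.r₁_ne_one] at hz'

/-- Codes exist as soon as `Y` is large. -/
theorem exists_isCoded (L : Layout 𝔊 G) (hG : #G ≤ #Y) (hQ : #Q ≤ #Y) (hR : #R ≤ #Y) :
    ∃ p, L.IsCoded p := by
  have := 𝔊.infinite
  have hY : ℵ₀ ≤ #Y := aleph0_le_mk Y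
  have hΛ : #Y ≤ #(G × (ℤ × Y)) :=
    mk_le_of_injective (f := fun y : Y => ((1 : G), ((0 : ℤ), y))) fun a b h => by simpa using h
  have hc : ∀ i, L.generator i ∈ 𝔊.controlled L.source L.μ := fun i =>
    Gadget.controls_univ (hY.trans hΛ) hΛ L.range_μ _ fun z hz => absurd (Set.mem_univ _) hz
  choose F hF hFN using hc
  have hI : #(G ⊕ Q ⊕ R ⊕ Bool) ≤ #Y := by
    simp only [mk_sum, lift_id, lift_uzero]
    refine add_le_of_le hY hG (add_le_of_le hY hQ (add_le_of_le hY hR ?_))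
    simpa using (natCast_le_aleph0 (n := 2)).trans hY
  set X : Set (Perm (G × (ℤ × Y))) := {shift} ∪ ⋃ i, tail '' F i with hX
  have hXc : #X ≤ #Y := by
    refine (mk_union_le _ _).trans (add_le_of_le hY ?_ ?_)
    · simpa using one_le_aleph0.trans hY
    · refine (mk_iUnion_le _).trans ?_
      refine (mul_le_mul' hI (ciSup_le' fun i => ?_)).trans (mul_eq_self hY).le
      exact ((hF i).image _).lt_aleph0.le.trans hY
  obtain ⟨e⟩ := hXc
  have hne : Nonempty X := ⟨⟨shift, Or.inl rfl⟩⟩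
  obtain ⟨hs⟩ : Nonempty (∀ x ∈ X, ∃ u, ((Function.invFun e u : X) : Perm (G × (ℤ × Y))) = x) :=
    ⟨fun x hx => ⟨e ⟨x, hx⟩, by rw [Function.leftInverse_invFun e.injective]⟩⟩
  refine ⟨fun u => (Function.invFun e u : X), hs _ (Or.inl rfl), fun i => ⟨F i, fun x hx =>
    hs _ (Or.inr (Set.mem_iUnion.2 ⟨i, x, hx, rfl⟩)), fun N hN h => ?_⟩⟩
  exact hFN i _ (L.isAdmissible _) N hN h

end Layout

theorem Gadget.exists_layout {Q R Y : Type u} [Group Q] [Group R] [Nontrivial R]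
    (𝔊 : Gadget Q R Y) (G : Type u) [Nonempty G] (hG : #G ≤ #Y) : Nonempty (Layout 𝔊 G) := by
  have := 𝔊.infinite
  have hY : ℵ₀ ≤ #Y := aleph0_le_mk Y
  have hYc : #Y ≤ #𝔊.codePort := (le_max_left _ _).trans 𝔊.mk_le
  have hR : #R ≤ #𝔊.codePort :=
    (le_max_right _ _).trans ((le_max_right _ _).trans ((le_max_right _ _).trans 𝔊.mk_le))
  have hc : ℵ₀ ≤ #𝔊.codePort := hY.trans hYc
  obtain ⟨e⟩ : #(R × Option (Y × (ℕ ⊕ ℕ))) ≤ #𝔊.codePort := by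
    rw [mk_prod, lift_id, lift_id]
    refine (mul_le_mul' hR ?_).trans (mul_eq_self hc).le
    rw [mk_option, mk_prod]
    refine add_le_of_le hc ?_ (one_le_aleph0.trans hc)
    simp only [mk_sum, lift_uzero, mk_nat, aleph0_add_aleph0]
    simpa using mul_le_of_le hc hYc hc
  have hΛ : #(G × (ℤ × Y)) ≤ #Y := by
    have hZ : lift.{u, 0} #ℤ ≤ #Y := by simp
    simp only [mk_prod, lift_id, lift_uzero]
    exact mul_le_of_le hY hG (mul_le_of_le hY hZ le_rfl)
  have hΛ' : #Y ≤ #(G × (ℤ × Y)) := by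
    obtain ⟨g⟩ := ‹Nonempty G›
    exact mk_le_of_injective (f := fun y : Y => (g, ((0 : ℤ), y))) fun a b h => by simpa using h
  obtain ⟨f⟩ : Nonempty (Y ≃ {z : Y × (G × (ℤ × Y)) | z.1 ∈ 𝔊.ctrlPort}) := by
    rw [← Cardinal.eq]
    refine le_antisymm ?_ ((mk_set_le _).trans ?_)
    · obtain ⟨y, hy⟩ := 𝔊.ctrlPort_nontrivial.nonempty
      exact hΛ'.trans (mk_le_of_injective (f := fun l => ⟨(y, l), hy⟩) fun a b h => by
        simpa using h)
    · rw [mk_prod, lift_id, lift_id]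
      exact (mul_le_mul' le_rfl hΛ).trans (mul_eq_self hY).le
  obtain ⟨r, hr⟩ := exists_ne (1 : R)
  exact ⟨⟨e.trans (Function.Embedding.subtype _), fun a => (e a).2,
    f.toEmbedding.trans (Function.Embedding.subtype _), by
      ext z
      constructor
      · rintro ⟨y, rfl⟩; exact (f y).2
      · intro hz; exact ⟨f.symm ⟨z, hz⟩, by simp⟩, r, hr⟩⟩

/-- `G` embeds into a simple group generated by copies of `H` and `K`. -/
def EmbedsIntoSimple (G H K : Type u) [Group G] [Group H] [Group K] : Prop :=
  ∃ (S : Type u) (_ : Group S), IsSimpleGroup S ∧ (∃ φ : G →* S, Function.Injective φ) ∧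
    ∃ (ψ : H →* S) (χ : K →* S), Function.Injective ψ ∧ Function.Injective χ ∧
      Subgroup.closure (Set.range ψ ∪ Set.range χ) = ⊤

theorem EmbedsIntoSimple.symm {G H K : Type u} [Group G] [Group H] [Group K]
    (h : EmbedsIntoSimple G H K) : EmbedsIntoSimple G K H := by
  obtain ⟨S, hS, h1, h2, ψ, χ, h3, h4, h5⟩ := h
  exact ⟨S, hS, h1, h2, χ, ψ, h4, h3, by rwa [Set.union_comm]⟩

/-- Among the normal subgroups avoiding a nontrivial element there is a maximal one. -/
theorem exists_maximal_normal {T : Type*} [Group T] {t : T}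
    (h1 : t ≠ 1) :
    ∃ M : Subgroup T, Maximal (fun N => N.Normal ∧ t ∉ N) M := by
  refine (zorn_le_nonempty₀ {N : Subgroup T | N.Normal ∧ t ∉ N} (fun c hc hch N hN => ?_) ⊥
    ⟨inferInstance, by simpa using h1⟩).imp fun M hM => hM.2
  have hd := hch.directedOn
  refine ⟨sSup c, ⟨⟨fun n hn g => ?_⟩, fun h => ?_⟩, fun N hN => le_sSup hN⟩
  · rw [Subgroup.mem_sSup_of_directedOn ⟨N, hN⟩ hd] at hn ⊢
    obtain ⟨N', hN', hn⟩ := hn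
    exact ⟨N', hN', (hc hN').1.conj_mem n hn g⟩
  · rw [Subgroup.mem_sSup_of_directedOn ⟨N, hN⟩ hd] at h
    obtain ⟨N', hN', h⟩ := h
    exact (hc hN').2 h

theorem embedsIntoSimple_of_normal {G H K T : Type u} [Group G] [Group H] [Group K] [Group T]
    [Nontrivial K] (φ : G →* T) (ψ : H →* T) (χ : K →* T)
    (hφ : ∀ N : Subgroup T, N.Normal → ∀ g, g ≠ 1 → φ g ∈ N → N = ⊤)
    (hψ : ∀ N : Subgroup T, N.Normal → ∀ h, h ≠ 1 → ψ h ∈ N → N = ⊤)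
    (hχ : ∀ N : Subgroup T, N.Normal → ∀ k, k ≠ 1 → χ k ∈ N → N = ⊤)
    (hχ' : Function.Injective χ)
    (hgen : Subgroup.closure (Set.range ψ ∪ Set.range χ) = ⊤) : EmbedsIntoSimple G H K := by
  obtain ⟨k, hk⟩ := exists_ne (1 : K)
  have hk' : χ k ≠ 1 := fun h => hk (hχ' (by rw [h, map_one]))
  obtain ⟨M, ⟨hM, hkM⟩, hmax⟩ := exists_maximal_normal hk'
  have hMtop : M ≠ ⊤ := fun h => hkM (h ▸ Subgroup.mem_top _)
  have inj : ∀ {L : Type u} [Group L] (f : L →* T),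
      (∀ N : Subgroup T, N.Normal → ∀ g, g ≠ 1 → f g ∈ N → N = ⊤) →
      Function.Injective ((QuotientGroup.mk' M).comp f) := by
    intro L _ f hf
    rw [injective_iff_map_eq_one]
    intro g hg
    by_contra h
    exact hMtop (hf M hM g h ((QuotientGroup.eq_one_iff _).1 hg))
  refine ⟨T ⧸ M, inferInstance, ?_, ⟨_, inj φ hφ⟩, _, _, inj ψ hψ, inj χ hχ, ?_⟩
  · have : Nontrivial (T ⧸ M) := QuotientGroup.nontrivial_iff.2 hMtop
    refine ⟨fun N hN => ?_⟩
    by_cases h : χ k ∈ N.comap (QuotientGroup.mk' M)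
    · right
      have := hχ _ (hN.comap _) k hk h
      rw [eq_top_iff]
      intro s _
      obtain ⟨t, rfl⟩ := QuotientGroup.mk'_surjective M s
      have ht : t ∈ N.comap (QuotientGroup.mk' M) := this ▸ Subgroup.mem_top t
      exact ht
    · left
      have := hmax ⟨hN.comap _, h⟩ fun m hm => by
        rw [Subgroup.mem_comap, QuotientGroup.mk'_apply, (QuotientGroup.eq_one_iff m).2 hm]
        exact N.one_mem
      rw [eq_bot_iff]
      intro s hs
      obtain ⟨t, rfl⟩ := QuotientGroup.mk'_surjective M s
      exact (QuotientGroup.eq_one_iff t).2 (this hs)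
  · have := congrArg (Subgroup.map (QuotientGroup.mk' M)) hgen
    rw [MonoidHom.map_closure, Set.image_union, ← Set.range_comp, ← Set.range_comp,
      Subgroup.map_top_of_surjective _ (QuotientGroup.mk'_surjective M)] at this
    exact this

theorem Gadget.embedsIntoSimple {Q R Y : Type u} [Group Q] [Group R] [Nontrivial R]
    (𝔊 : Gadget Q R Y) (G : Type u) [Group G] (hG : #G ≤ max ℵ₀ (max #Q #R)) :
    EmbedsIntoSimple G Q R := by
  have hc : #𝔊.codePort ≤ #Y := mk_set_le _
  have hm := 𝔊.mk_le.trans hc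
  have hG' := (hG.trans (le_max_right _ _)).trans hm
  obtain ⟨L⟩ := 𝔊.exists_layout G hG'
  obtain ⟨p, hp⟩ := L.exists_isCoded hG'
    (le_trans (((le_max_left _ _).trans (le_max_right _ _)).trans (le_max_right _ _)) hm)
    (le_trans (((le_max_right _ _).trans (le_max_right _ _)).trans (le_max_right _ _)) hm)
  have key : ∀ N : Subgroup (L.group p), N.Normal →
      Gadget.Normalizes (L.group p) (N.map (L.group p).subtype) := by
    rintro N hN t ht _ ⟨n, hn, rfl⟩
    exact ⟨_, hN.conj_mem n hn ⟨t, ht⟩, rfl⟩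
  have top : ∀ N : Subgroup (L.group p), L.group p ≤ N.map (L.group p).subtype → N = ⊤ := by
    intro N h
    rw [eq_top_iff]
    intro t _
    obtain ⟨n, hn, hnt⟩ := h t.2
    exact Subtype.ext hnt ▸ hn
  refine embedsIntoSimple_of_normal
    ((fibreHom Y Y G).codRestrict (L.group p) (Layout.fibreHom_mem hp))
    (((amplify (G × (ℤ × Y))).comp 𝔊.α).codRestrict (L.group p) (L.amplify_α_mem p))
    ((L.codeHom p).codRestrict (L.group p) (L.codeHom_mem p))
    (fun N hN g hg h => top N (Layout.group_le_of_fibreHom_mem hp (key N hN) hg ⟨_, h, rfl⟩))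
    (fun N hN g hg h => top N (Layout.group_le_of_amplify_mem hp (key N hN) hg ⟨_, h, rfl⟩))
    (fun N hN g hg h => top N (Layout.group_le_of_codeHom_mem hp (key N hN) hg ⟨_, h, rfl⟩))
    ?_ ?_
  · rw [injective_iff_map_eq_one]
    intro r hr
    have := 𝔊.infinite
    obtain ⟨u⟩ := (inferInstance : Nonempty Y)
    have h1 : L.codeHom p r = 1 := congrArg Subtype.val hr
    have h2 := L.codeHom_of_code_eq_one p (r := r) (s := 1) (u := u) (a := .inr 0) rfl rfl
      (1, 0, u)
    rw [h1, Perm.one_apply, Prod.mk.injEq, L.codePort.injective.eq_iff] at h2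
    simpa using h2.1.symm
  · refine Eq.trans (congrArg Subgroup.closure ?_) (Subgroup.closure_closure_coe_preimage
      (k := Set.range (fun q => amplify (G × (ℤ × Y)) (𝔊.α q)) ∪ Set.range (L.codeHom p)))
    ext ⟨t, ht⟩
    simp only [Set.mem_union, Set.mem_range, Subtype.ext_iff]
    rfl

theorem amplify_threeCycle_mem {Q R Y Λ : Type u} [Group Q] [Group R] (α : Q →* Perm Y)
    (ρ : R →* Perm Y) (E : Set Y) (hE : ∀ r, ∀ y ∈ E, ρ r y = y) (ψ : R →* Perm (Y × Λ))
    (hψ : ∀ r, IsClean (ψ r) (ρ r) E) (T : Subgroup (Perm (Y × Λ)))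
    (hαT : ∀ q, amplify Λ (α q) ∈ T) (hψT : ∀ r, ψ r ∈ T)
    {d b c : Y} (hdb : d ≠ b) (hdc : d ≠ c) (hbc : b ≠ c) (hd : d ∉ E) (hb : b ∉ E) (hc : c ∉ E)
    (hdbc : amplify Λ (threeCycle d b c) ∈ T) (hdα : ∀ q, α q d = d)
    (hmeet : ∀ r, ∃ y ∈ ({d, b, c} : Set Y), ρ r y ∈ ({d, b, c} : Set Y))
    (htrans : ∀ S : Set Y, d ∈ S → (∀ q, ∀ y ∈ S, α q y ∈ S) → (∀ r, ∀ y ∈ S, ρ r y ∈ S) →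
      S = Set.univ)
    {x y z : Y} (hxy : x ≠ y) (hxz : x ≠ z) (hyz : y ≠ z) :
    amplify Λ (threeCycle x y z) ∈ T := by
  refine threeCycle_mem_of_growth (C := T.comap (amplify Λ)) α ρ E hE ?_ ?_ hdb hdc hbc hd hb hc
    hdbc hdα hmeet htrans hxy hxz hyz
  · intro q σ hσ
    rw [Subgroup.mem_comap, map_mul, map_mul, map_inv]
    exact T.mul_mem (T.mul_mem (hαT q) hσ) (T.inv_mem (hαT q))
  · intro r σ hσ hfix
    have h1 := (isClean_amplify (Λ := Λ) σ ∅).conj (hψ r) hfix (Set.empty_disjoint _)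
    rw [Set.image_empty] at h1
    rw [Subgroup.mem_comap, ← h1.eq_amplify]
    exact T.mul_mem (T.mul_mem (hψT r) hσ) (T.inv_mem (hψT r))

namespace Ladder
variable {Q R : Type u} [Group Q] [Group R]

variable (Q R) in
/-- The points: a base point and copies of `Q` indexed by `R ∖ 1` and the levels. -/
abbrev Point : Type u := Option (Q × ({j : R // j ≠ 1} × ℕ))

variable (R) in
/-- The action of `Q` on the left. -/
def leftHom : Q →* Perm (Point Q R) where
  toFun q := optionCongr (amplify _ (Equiv.mulLeft q))
  map_one' := by ext1 (_ | ⟨x, a⟩) <;> simp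
  map_mul' q q' := by ext1 (_ | ⟨x, a⟩) <;> simp

@[simp] theorem leftHom_none (q : Q) : leftHom R q none = none := rfl

@[simp] theorem leftHom_some (q x : Q) (a) : leftHom R q (some (x, a)) = some (q * x, a) := rfl

variable (g : Q) (j₀ : {j : R // j ≠ 1})

open scoped Classical in
/-- The free `R`-orbits, numbered by the levels. -/
noncomputable def rung : R × ℕ → Point Q R
  | (r, 0) => if h : r = 1 then none else some (1, ⟨r, h⟩, 0)
  | (r, n + 1) => if h : r = 1 then some (g, j₀, n) else some (1, ⟨r, h⟩, n + 1)

theorem rung_one_zero : rung g j₀ (1, 0) = none := by simp [rung]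

theorem rung_one_succ (n : ℕ) : rung g j₀ (1, n + 1) = some (g, j₀, n) := by simp [rung]

theorem rung_val (j : {j : R // j ≠ 1}) (n : ℕ) : rung g j₀ (j, n) = some (1, j, n) := by
  cases n <;> simp [rung, j.2]

theorem rung_cases (a : R × ℕ) : a = (1, 0) ∨ (∃ n, a = (1, n + 1)) ∨
    ∃ (j : {j : R // j ≠ 1}) (n : ℕ), a = (j.1, n) := by
  obtain ⟨r, n⟩ := a
  by_cases hr : r = 1
  · subst hr
    cases n
    · exact Or.inl rfl
    · exact Or.inr (Or.inl ⟨_, rfl⟩)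
  · exact Or.inr (Or.inr ⟨⟨r, hr⟩, n, rfl⟩)

variable {g}

theorem rung_injective (hg : g ≠ 1) : Function.Injective (rung g j₀) := by
  intro a b h
  rcases rung_cases a with rfl | ⟨n, rfl⟩ | ⟨j, n, rfl⟩ <;>
    rcases rung_cases b with rfl | ⟨m, rfl⟩ | ⟨j', m, rfl⟩ <;>
    simp only [rung_one_zero, rung_one_succ, rung_val] at h <;> simp_all [eq_comm]

/-- The action of `R`, free on the rungs and trivial elsewhere. -/
noncomputable def rungHom (hg : g ≠ 1) : R →* Perm (Point Q R) :=
  (Perm.viaEmbeddingHom ⟨rung g j₀, rung_injective j₀ hg⟩).comp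
    ((amplify _).comp (MulAction.toPermHom R R))

variable (hg : g ≠ 1)

theorem rungHom_rung (r s : R) (n : ℕ) :
    rungHom j₀ hg r (rung g j₀ (s, n)) = rung g j₀ (r * s, n) :=
  Perm.viaEmbedding_apply _ (⟨rung g j₀, rung_injective j₀ hg⟩ : _ ↪ _) (s, n)

theorem rungHom_of_notMem (r : R) {y : Point Q R} (hy : y ∉ Set.range (rung g j₀)) :
    rungHom j₀ hg r y = y :=
  Perm.viaEmbedding_apply_of_notMem _ _ _ hy

theorem rung_ne_some {x : Q} {j : {j : R // j ≠ 1}} {n : ℕ} (hx : x ≠ 1)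
    (hxj : ¬ (x = g ∧ j = j₀)) : some (x, j, n) ∉ Set.range (rung g j₀) := by
  rintro ⟨a, ha⟩
  rcases rung_cases a with rfl | ⟨m, rfl⟩ | ⟨j', m, rfl⟩
  · rw [rung_one_zero] at ha; cases ha
  · rw [rung_one_succ] at ha
    simp only [Option.some.injEq, Prod.mk.injEq] at ha
    exact hxj ⟨ha.1.symm, ha.2.1.symm⟩
  · rw [rung_val] at ha
    simp only [Option.some.injEq, Prod.mk.injEq] at ha
    exact hx ha.1.symm

variable (g) in
/-- The points `(x, j, n)` with `x ∈ P` off the rungs and satisfying `c`. -/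
def ports (P : Set Q) (c : Q → ℕ → Prop) : Set (Point Q R) :=
  {y | ∃ x j n, y = some (x, j, n) ∧ x ∈ P ∧ x ≠ 1 ∧ ¬ (x = g ∧ j = j₀) ∧ c x n}

variable {j₀}

theorem some_mem_ports {P : Set Q} {c : Q → ℕ → Prop} {x : Q} {j : {j : R // j ≠ 1}} {n : ℕ} :
    some (x, j, n) ∈ ports g j₀ P c ↔ x ∈ P ∧ x ≠ 1 ∧ ¬ (x = g ∧ j = j₀) ∧ c x n := by
  constructor
  · rintro ⟨x', j', n', h, h'⟩
    simp only [Option.some.injEq, Prod.mk.injEq] at h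
    obtain ⟨rfl, rfl, rfl⟩ := h
    exact h'
  · exact fun h => ⟨x, j, n, rfl, h⟩

theorem none_notMem_ports {P : Set Q} {c : Q → ℕ → Prop} : none ∉ ports g j₀ P c := by
  rintro ⟨x, j, n, h, -⟩
  cases h

theorem ports_union (P : Set Q) (c : Q → ℕ → Prop) :
    ports g j₀ P c ∪ ports g j₀ P (fun x n => ¬ c x n) = ports g j₀ P fun _ _ => True := by
  ext (_ | ⟨x, j, n⟩)
  · simp [none_notMem_ports]
  · simp only [Set.mem_union, some_mem_ports]
    tauto

theorem commutator_rungHom (P : Set Q) (h1 : 1 ∈ P) (hgP : g ∈ P) {q : Q}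
    (hq : ∀ x ∈ P, q * x ∉ P) (r : R) (hr : r ≠ 1) :
    ⁅rungHom j₀ hg r, leftHom R q * rungHom j₀ hg r * (leftHom R q)⁻¹⁆ =
      threeCycle none (some (1, ⟨r, hr⟩, 0)) (some (q, ⟨r, hr⟩, 0)) := by
  have e1 : rungHom j₀ hg r none = some (1, ⟨r, hr⟩, 0) := by
    rw [← rung_one_zero g j₀, rungHom_rung, mul_one]
    exact rung_val g j₀ ⟨r, hr⟩ 0
  have e2 : (leftHom R q * rungHom j₀ hg r * (leftHom R q)⁻¹) none = some (q, ⟨r, hr⟩, 0) := by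
    rw [Perm.mul_apply, Perm.mul_apply, ← map_inv, leftHom_none, e1, leftHom_some, mul_one]
  rw [commutator_eq_threeCycle (d := none) (by rw [e1]; simp) (by rw [e2]; simp), e1, e2]
  intro y hy
  obtain _ | ⟨x, j, n⟩ := y
  · exact absurd rfl hy
  by_cases hx : x ∈ P
  · right
    rw [Perm.mul_apply, Perm.mul_apply, ← map_inv, leftHom_some, rungHom_of_notMem, leftHom_some,
      mul_inv_cancel_left]
    refine rung_ne_some _ (fun h => ?_) (fun h => ?_)
    · exact hq 1 h1 (by rwa [← h, mul_inv_cancel_left])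
    · exact hq g hgP (by rwa [← h.1, mul_inv_cancel_left])
  · left
    exact rungHom_of_notMem _ _ _ (rung_ne_some _ (fun h => hx (h ▸ h1)) fun h => hx (h.1 ▸ hgP))

theorem rungHom_ports (P : Set Q) (r : R) {y : Point Q R} (hy : y ∈ ports g j₀ P fun _ _ => True) :
    rungHom j₀ hg r y = y := by
  obtain ⟨x, j, n, rfl, -, hx, hxj, -⟩ := hy
  exact rungHom_of_notMem _ _ _ (rung_ne_some _ hx hxj)

theorem eq_univ_of_invariant (S : Set (Point Q R)) (hS : none ∈ S)
    (hα : ∀ q, ∀ y ∈ S, leftHom R q y ∈ S) (hρ : ∀ r, ∀ y ∈ S, rungHom j₀ hg r y ∈ S) :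
    S = Set.univ := by
  have hlevel : ∀ n, rung g j₀ (1, n) ∈ S → ∀ x j, some (x, j, n) ∈ S := by
    intro n h x j
    have h1 := hα x _ (hρ j _ h)
    rwa [rungHom_rung, mul_one, rung_val, leftHom_some, mul_one] at h1
  have hall : ∀ n, rung g j₀ (1, n) ∈ S := by
    intro n
    induction n with
    | zero => rwa [rung_one_zero]
    | succ n ih => rw [rung_one_succ]; exact hlevel n ih _ _
  ext (_ | ⟨x, j, n⟩)
  · simpa using hS
  · simpa using hlevel n (hall n) x j

theorem threeCycle_mem (P : Set Q) (h1 : 1 ∈ P) (hgP : g ∈ P) {q : Q} (hq : ∀ x ∈ P, q * x ∉ P)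
    (Λ : Type u) (ψ : R →* Perm (Point Q R × Λ))
    (hψ : ∀ r, IsClean (ψ r) (rungHom j₀ hg r) (ports g j₀ P fun _ _ => True))
    (T : Subgroup (Perm (Point Q R × Λ)))
    (hα : ∀ q, amplify Λ (leftHom R q) ∈ T) (hT : ∀ r, ψ r ∈ T) (a b c : Point Q R) (hab : a ≠ b)
    (hac : a ≠ c) (hbc : b ≠ c) : amplify Λ (threeCycle a b c) ∈ T := by
  have hq1 : q ≠ 1 := fun h => hq 1 h1 (by rwa [h, mul_one])
  have hqP : q ∉ P := by simpa using hq 1 h1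
  refine amplify_threeCycle_mem (leftHom R) (rungHom j₀ hg) (ports g j₀ P fun _ _ => True)
    (fun r y hy => rungHom_ports hg P r hy) ψ hψ T hα hT (d := none) (b := some (1, j₀, 0))
    (c := some (q, j₀, 0)) (by simp) (by simp) (by simp [hq1.symm]) none_notMem_ports ?_ ?_ ?_
    leftHom_none ?_ (eq_univ_of_invariant hg) hab hac hbc
  · rw [some_mem_ports]; simp
  · rw [some_mem_ports]; simp [hqP]
  · rw [← commutator_rungHom hg P h1 hgP hq j₀.1 j₀.2]
    have hc := (hψ j₀.1).conj (isClean_amplify (Λ := Λ) (leftHom R q) ∅) (by simp)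
      (Set.disjoint_empty _)
    rw [← IsClean.commutator (hψ j₀.1) hc (fun y hy => rungHom_ports hg P _ hy)]
    · rw [commutatorElement_def]
      have hz := T.mul_mem (T.mul_mem (hα q) (hT j₀.1)) (T.inv_mem (hα q))
      exact T.mul_mem (T.mul_mem (T.mul_mem (hT _) hz) (T.inv_mem (hT _))) (T.inv_mem hz)
    · rintro _ ⟨_, ⟨x, j, n, rfl, hx, -⟩, rfl⟩
      rw [leftHom_some]
      exact rungHom_of_notMem _ _ _ (rung_ne_some _ (fun h => hq x hx (h ▸ h1))
        fun h => hq x hx (h.1 ▸ hgP))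
    · rintro _ ⟨x, j, n, rfl, hx, -⟩
      rw [Perm.mul_apply, Perm.mul_apply, ← map_inv, leftHom_some, rungHom_of_notMem, leftHom_some,
        mul_inv_cancel_left]
      refine rung_ne_some _ (fun h => ?_) (fun h => ?_)
      · exact hq 1 h1 (by rwa [← h, mul_inv_cancel_left])
      · exact hq g hgP (by rwa [← h.1, mul_inv_cancel_left])
    · rintro _ ⟨y, hy, rfl⟩
      simp only [Perm.mul_apply]
      rw [show (leftHom R q)⁻¹ (leftHom R q y) = y by simp, rungHom_ports hg P _ hy]
    · rw [Set.disjoint_left]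
      rintro _ ⟨x, j, n, rfl, hx, -⟩ ⟨_, ⟨x', j', n', rfl, hx', -⟩, h⟩
      simp only [leftHom_some, Option.some.injEq, Prod.mk.injEq] at h
      exact hq x' hx' (h.1 ▸ hx)
  · intro r
    refine ⟨some (q, j₀, 0), by simp, ?_⟩
    rw [rungHom_of_notMem _ _ _ (rung_ne_some _ hq1 fun h => hqP (h.1 ▸ hgP))]
    simp

/-- The gadget with the given ports. -/
noncomputable def gadget (P : Set Q) (h1 : 1 ∈ P) (hgP : g ∈ P) {q : Q}
    (hq : ∀ x ∈ P, q * x ∉ P) (c : Q → ℕ → Prop)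
    (reach : ∀ D : Set (Point Q R) → Prop, (∀ A B, A ⊆ B → D B → D A) →
      (∀ A B, D A → D B → D (A ∪ B)) → (∀ y, D {y}) → (∀ (q' : Q) A, D A → D (leftHom R q' '' A)) →
      (∀ (r : R) A, D A → Disjoint A (ports g j₀ P fun _ _ => True) → D (rungHom j₀ hg r '' A)) →
      D (ports g j₀ P fun x n => ¬ c x n) → D Set.univ)
    (mk_le : max #(Point Q R) (max ℵ₀ (max #Q #R)) ≤ #(ports g j₀ P c))
    (nontrivial : (ports g j₀ P fun x n => ¬ c x n).Nontrivial) : Gadget Q R (Point Q R) where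
  α := leftHom R
  ρ := rungHom j₀ hg
  codePort := ports g j₀ P c
  ctrlPort := ports g j₀ P fun x n => ¬ c x n
  disjoint := by
    rw [Set.disjoint_left]
    rintro _ ⟨x, j, n, rfl, h⟩ h'
    rw [some_mem_ports] at h'
    tauto
  fixed := by
    rw [ports_union]
    exact fun r y => rungHom_ports hg P r
  threeCycle_mem := by
    rw [ports_union]
    exact threeCycle_mem hg P h1 hgP hq
  reach := by
    rw [ports_union]
    exact reach
  mk_le := mk_le
  ctrlPort_nontrivial := nontrivial
  compl_nontrivial := by
    rw [ports_union]
    refine ⟨none, none_notMem_ports, some (1, j₀, 0), ?_, by simp⟩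
    rw [Set.mem_compl_iff, some_mem_ports]
    simp
  moves q hq := ⟨some (1, j₀, 0), some (1, j₀, 1), some (1, j₀, 2), by simp [hq]⟩

end Ladder

/-- A subset through `1` that is separated by `F` and of which finitely many translates cover. -/
theorem exists_separated_cover {Q : Type u} [Group Q] (F : Set Q) (hF : F.Finite) (h1 : 1 ∉ F) :
    ∃ B : Set Q, 1 ∈ B ∧ (∀ s ∈ F, ∀ x ∈ B, s * x ∉ B) ∧
      ∃ F' : Set Q, F'.Finite ∧ ∀ y, ∃ f ∈ F', ∃ x ∈ B, y = f * x := by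
  obtain ⟨B, h1B, hB⟩ := zorn_subset_nonempty {B : Set Q | ∀ s ∈ F, ∀ x ∈ B, s * x ∉ B} (by
    intro c hc hchain _
    refine ⟨⋃₀ c, ?_, fun s hs => Set.subset_sUnion_of_mem hs⟩
    rintro s hs x ⟨X, hX, hx⟩ ⟨Z, hZ, hz⟩
    rcases hchain.total hX hZ with h | h
    · exact hc hZ s hs x (h hx) hz
    · exact hc hX s hs x hx (h hz)) {1} (by
    rintro s hs x rfl hx
    rw [mul_one] at hx
    exact h1 (Set.mem_singleton_iff.1 hx ▸ hs))
  refine ⟨B, h1B rfl, hB.prop, insert 1 (F ∪ F⁻¹), (hF.union hF.inv).insert 1, fun y => ?_⟩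
  by_cases hy : y ∈ B
  · exact ⟨1, Set.mem_insert _ _, y, hy, (one_mul y).symm⟩
  · by_contra! hcon
    refine hy (hB.le_of_ge (y := insert y B) ?_ (Set.subset_insert y B) (Set.mem_insert y B))
    rintro s hs x (rfl | hx) (h | h)
    · rw [_root_.mul_eq_right] at h
      exact h1 (h ▸ hs)
    · exact hcon s⁻¹ (Or.inr (Or.inr (Set.inv_mem_inv.2 hs))) _ h (inv_mul_cancel_left s x).symm
    · exact hcon s (Or.inr (Or.inl hs)) _ hx h.symm
    · exact hB.prop s hs x hx h

theorem iUnion_of_finite {Y : Type u} {D : Set Y → Prop} (hmono : ∀ A B, A ⊆ B → D B → D A)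
    (hunion : ∀ A B, D A → D B → D (A ∪ B)) (y : Y) (hy : D {y}) {ι : Type v} {s : Set ι}
    (hs : s.Finite) (A : ι → Set Y) (hA : ∀ i ∈ s, D (A i)) : D (⋃ i ∈ s, A i) := by
  induction s, hs using Set.Finite.induction_on with
  | empty => exact hmono _ _ (by simp) hy
  | insert _ _ ih =>
    rw [Set.biUnion_insert]
    exact hunion _ _ (hA _ (Set.mem_insert _ _)) (ih fun i hi => hA i (Set.mem_insert_of_mem _ hi))

namespace Ladder
variable {Q R : Type u} [Group Q] [Group R]

theorem embedsIntoSimple_of_infinite (G Q R : Type u) [Group G] [Group Q] [Group R] [Infinite Q]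
    [Nontrivial R] (hG : #G ≤ max ℵ₀ (max #Q #R)) : EmbedsIntoSimple G Q R := by
  obtain ⟨q, hq⟩ := exists_ne (1 : Q)
  obtain ⟨h, hh⟩ := (Set.toFinite ({1, q, q⁻¹} : Set Q)).exists_notMem
  simp only [Set.mem_insert_iff, Set.mem_singleton_iff, not_or] at hh
  obtain ⟨hh1, hhq, hhq'⟩ := hh
  obtain ⟨B, h1B, hB, F', hF', hcov⟩ := exists_separated_cover
    ({q, h, q * h, h⁻¹ * q, h⁻¹ * (q * h)} : Set Q) (Set.toFinite _) (by
      simp only [Set.mem_insert_iff, Set.mem_singleton_iff, not_or]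
      refine ⟨hq.symm, Ne.symm hh1, fun e => hhq' ?_, fun e => hhq ?_, fun e => hq ?_⟩
      · exact eq_inv_of_mul_eq_one_right e.symm
      · exact (inv_mul_eq_one.1 e.symm)
      · simpa using (inv_mul_eq_one.1 e.symm).symm)
  have hBinf : B.Infinite := by
    intro hfin
    refine Set.infinite_univ (α := Q) ((Set.Finite.image2 (· * ·) hF' hfin).subset fun y _ => ?_)
    obtain ⟨f, hf, x, hx, rfl⟩ := hcov y
    exact Set.mem_image2_of_mem hf hx
  obtain ⟨g, ⟨hgB, hg1⟩, k, ⟨hkB, hk1⟩, hgk⟩ := (hBinf.sdiff (Set.finite_singleton 1)).nontrivial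
  obtain ⟨r₀, hr₀⟩ := exists_ne (1 : R)
  have hP : ∀ x ∈ B ∪ (h * ·) '' B, q * x ∉ B ∪ (h * ·) '' B := by
    rintro x (hx | ⟨b, hb, rfl⟩) (h' | ⟨b', hb', h'⟩)
    · exact hB q (by simp) x hx h'
    · refine hB (h⁻¹ * q) (by simp) x hx ?_
      rw [mul_assoc, ← h']
      simpa using hb'
    · refine hB (q * h) (by simp) b hb ?_
      rwa [mul_assoc]
    · refine hB (h⁻¹ * (q * h)) (by simp) b hb ?_
      rw [mul_assoc, mul_assoc, ← h']
      simpa using hb'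
  let j₀ : {j : R // j ≠ 1} := ⟨r₀, hr₀⟩
  have hctrl : ∀ x ∈ B, x ≠ 1 → x ≠ g → ∀ j n, some (x, j, n) ∈
      ports g j₀ (B ∪ (h * ·) '' B) fun x _ => ¬ x ∉ B := fun x hx hx1 hxg j n =>
    some_mem_ports.2 ⟨Or.inl hx, hx1, fun h => hxg h.1, not_not.2 hx⟩
  refine (gadget (j₀ := j₀) hg1 (B ∪ (h * ·) '' B) (Or.inl h1B) (Or.inl hgB) hP
    (fun x _ => x ∉ B) ?_ ?_ ?_).embedsIntoSimple G hG
  · intro D hmono hunion hsing hα hρ hD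
    have hk : D {y | ∃ a, y = some (k, a)} := hmono _ _ (by
      rintro _ ⟨⟨j, n⟩, rfl⟩
      exact hctrl k hkB hk1 (Ne.symm hgk) j n) hD
    have hx : ∀ x : Q, D {y | ∃ a, y = some (x, a)} := fun x => hmono _ _ (by
      rintro _ ⟨a, rfl⟩
      exact ⟨some (k, a), ⟨a, rfl⟩, by rw [leftHom_some, inv_mul_cancel_right]⟩) (hα (x * k⁻¹) _ hk)
    have hDB : D {y | ∃ x ∈ B, ∃ a, y = some (x, a)} := hmono _ _ (by
      rintro _ ⟨x, hx, ⟨j, n⟩, rfl⟩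
      by_cases hx1 : x = 1
      · exact Or.inl (Or.inl ⟨(j, n), by rw [hx1]⟩)
      · by_cases hxg : x = g
        · exact Or.inl (Or.inr ⟨(j, n), by rw [hxg]⟩)
        · exact Or.inr (hctrl x hx hx1 hxg j n)) (hunion _ _ (hunion _ _ (hx 1) (hx g)) hD)
    refine hmono _ _ ?_ (hunion _ _ (hsing none) (iUnion_of_finite hmono hunion none (hsing none)
      hF' _ fun f _ => hα f _ hDB))
    rintro (_ | ⟨y, a⟩) -
    · exact Or.inl rfl
    · obtain ⟨f, hf, x, hx, rfl⟩ := hcov y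
      exact Or.inr (Set.mem_biUnion hf ⟨some (x, a), ⟨x, hx, a, rfl⟩, rfl⟩)
  · have hκ : #(B × ({j : R // j ≠ 1} × ℕ)) ≤
        #(ports g j₀ (B ∪ (h * ·) '' B) fun x _ => x ∉ B) := by
      have hmem : ∀ (b : B) a, some (h * b.1, a) ∈
          ports g j₀ (B ∪ (h * ·) '' B) fun x _ => x ∉ B := by
        rintro b ⟨j, n⟩
        have hb := hB h (by simp) b b.2
        exact some_mem_ports.2 ⟨Or.inr ⟨b, b.2, rfl⟩, fun e => hb (e ▸ h1B),
          fun e => hb (e.1 ▸ hgB), hb⟩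
      refine mk_le_of_injective (f := fun b => ⟨_, hmem b.1 b.2⟩) fun b b' e => ?_
      simpa [Prod.ext_iff, Subtype.ext_iff] using e
    refine le_trans ?_ hκ
    set κ := #(B × ({j : R // j ≠ 1} × ℕ)) with hκd
    have : Infinite B := hBinf.to_subtype
    have : Nonempty {j : R // j ≠ 1} := ⟨j₀⟩
    have hκ0 : ℵ₀ ≤ κ := aleph0_le_mk _
    have hBκ : #B ≤ κ :=
      mk_le_of_injective (f := fun b => (b, j₀, 0)) fun a b h => (Prod.ext_iff.1 h).1
    have hJκ : #({j : R // j ≠ 1} × ℕ) ≤ κ :=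
      mk_le_of_injective (f := fun a => (⟨1, h1B⟩, a)) fun a b h => (Prod.ext_iff.1 h).2
    have hJκ' : #{j : R // j ≠ 1} ≤ κ :=
      le_trans (mk_le_of_injective (f := fun a => (a, 0)) fun a b h => (Prod.ext_iff.1 h).1) hJκ
    have hQ : #Q ≤ κ := by
      refine (mk_le_of_surjective (f := fun p : F' × B => p.1.1 * p.2.1) fun y => ?_).trans ?_
      · obtain ⟨f, hf, x, hx, rfl⟩ := hcov y
        exact ⟨(⟨f, hf⟩, ⟨x, hx⟩), rfl⟩
      · rw [← Cardinal.mul_def]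
        exact mul_le_of_le hκ0 (hF'.lt_aleph0.le.trans hκ0) hBκ
    have hR : #R ≤ κ := by
      refine (mk_le_of_surjective (f := fun o : Option {j : R // j ≠ 1} => o.elim 1 (↑))
        fun r => ?_).trans ?_
      · by_cases hr : r = 1
        · exact ⟨none, hr.symm⟩
        · exact ⟨some ⟨r, hr⟩, rfl⟩
      · rw [mk_option]
        exact add_le_of_le hκ0 hJκ' (one_le_aleph0.trans hκ0)
    refine max_le ?_ (max_le hκ0 (max_le hQ hR))
    rw [mk_option, ← Cardinal.mul_def]
    exact add_le_of_le hκ0 (mul_le_of_le hκ0 hQ hJκ) (one_le_aleph0.trans hκ0)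
  · exact ⟨_, hctrl k hkB hk1 (Ne.symm hgk) j₀ 0, _, hctrl k hkB hk1 (Ne.symm hgk) j₀ 1, by simp⟩

/-- The gadget of a ladder for finite groups, with ports on both sides at alternate levels. -/
theorem embedsIntoSimple_of_finite (G : Type u) [Group G] [Finite Q] [Finite R] [Nontrivial R]
    (hG : #G ≤ max ℵ₀ (max #Q #R)) {g : Q} (hg : g ≠ 1) (P : Set Q) (h1 : 1 ∈ P) (hgP : g ∈ P)
    {q : Q} (hq : ∀ x ∈ P, q * x ∉ P) (j₀ j₁ : {j : R // j ≠ 1}) {k : Q} (hk : k ∈ P) (hk1 : k ≠ 1)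
    (hkg : ¬ (k = g ∧ j₁ = j₀)) : EmbedsIntoSimple G Q R := by
  refine (gadget (j₀ := j₀) hg P h1 hgP hq (fun _ n => Even n) ?_ ?_ ?_).embedsIntoSimple G hG
  · intro D hmono hunion hsing hα hρ hD
    have hleft : ∀ (p : ℕ → Prop) (x y : Q) (j : {j : R // j ≠ 1}),
        D {z | ∃ n, z = some (x, j, n) ∧ p n} → D {z | ∃ n, z = some (y, j, n) ∧ p n} :=
      fun p x y j h => hmono _ _ (by
        rintro _ ⟨n, rfl, hn⟩
        exact ⟨some (x, j, n), ⟨n, rfl, hn⟩, by rw [leftHom_some, inv_mul_cancel_right]⟩)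
          (hα (y * x⁻¹) _ h)
    have hdisj : ∀ (p : ℕ → Prop) (j : {j : R // j ≠ 1}), Disjoint
        {z | ∃ n, z = some ((1 : Q), j, n) ∧ p n} (ports g j₀ P fun _ _ => True) := by
      intro p j
      rw [Set.disjoint_left]
      rintro _ ⟨n, rfl, -⟩ h
      exact (some_mem_ports.1 h).2.1 rfl
    have hodd : ∀ x j, D {z | ∃ n, z = some (x, j, n) ∧ ¬ Even n} := by
      intro x j
      have h2 : D {z | ∃ n, z = some (k, j₁, n) ∧ ¬ Even n} := hmono _ _ (by
        rintro _ ⟨n, rfl, hn⟩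
        exact some_mem_ports.2 ⟨hk, hk1, hkg, hn⟩) hD
      refine hleft _ 1 x j (hmono _ _ ?_ (hρ (j * (j₁ : R)⁻¹) _ (hleft _ k 1 j₁ h2) (hdisj _ _)))
      rintro _ ⟨n, rfl, hn⟩
      refine ⟨some (1, j₁, n), ⟨n, rfl, hn⟩, ?_⟩
      rw [← rung_val g j₀, rungHom_rung, inv_mul_cancel_right, rung_val]
    have heven : ∀ x, D {z | ∃ n, z = some (x, j₀, n) ∧ Even n} := by
      intro x
      refine hleft _ g x j₀ (hmono _ _ ?_ (hρ (j₀ : R)⁻¹ _ (hodd 1 j₀) (hdisj _ _)))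
      rintro _ ⟨n, rfl, hn⟩
      refine ⟨some (1, j₀, n + 1), ⟨n + 1, rfl, by simpa [Nat.even_add_one] using hn⟩, ?_⟩
      rw [← rung_val g j₀, rungHom_rung, inv_mul_cancel, rung_one_succ]
    have heven' : ∀ x j, D {z | ∃ n, z = some (x, j, n) ∧ Even n} := by
      intro x j
      refine hleft _ 1 x j (hmono _ _ ?_ (hρ (j * (j₀ : R)⁻¹) _ (heven 1) (hdisj _ _)))
      rintro _ ⟨n, rfl, hn⟩
      refine ⟨some (1, j₀, n), ⟨n, rfl, hn⟩, ?_⟩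
      rw [← rung_val g j₀, rungHom_rung, inv_mul_cancel_right, rung_val]
    refine hmono _ _ ?_ (hunion _ _ (hsing none) (iUnion_of_finite hmono hunion none (hsing none)
      (Set.finite_univ (α := Q × {j : R // j ≠ 1})) _
      fun a _ => hunion _ _ (hodd a.1 a.2) (heven' a.1 a.2)))
    rintro (_ | ⟨x, j, n⟩) -
    · exact Or.inl rfl
    · refine Or.inr (Set.mem_biUnion (Set.mem_univ (x, j)) ?_)
      by_cases hn : Even n
      · exact Or.inr ⟨n, rfl, hn⟩
      · exact Or.inl ⟨n, rfl, hn⟩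
  · refine le_trans (max_le mk_le_aleph0 (max_le le_rfl (max_le mk_le_aleph0 mk_le_aleph0))) ?_
    have hmem : ∀ n : ℕ, some (k, j₁, 2 * n) ∈ ports g j₀ P fun _ n => Even n := fun n =>
      some_mem_ports.2 ⟨hk, hk1, hkg, even_two_mul n⟩
    have := Infinite.of_injective (fun n : ℕ => (⟨_, hmem n⟩ : ports g j₀ P fun _ n => Even n))
      fun m n h => by simpa using h
    exact aleph0_le_mk _
  · exact ⟨_, some_mem_ports.2 ⟨hk, hk1, hkg, show ¬ Even 1 by decide⟩, _,
      some_mem_ports.2 ⟨hk, hk1, hkg, show ¬ Even 3 by decide⟩, by simp⟩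

theorem exists_notMem_of_lt_card {α : Type u} [Finite α] (s : Finset α) (h : s.card < Nat.card α) :
    ∃ x, x ∉ s := by
  by_contra! hs
  have := Fintype.ofFinite α
  rw [Nat.card_eq_fintype_card] at h
  exact absurd (Finset.card_le_card (fun x _ => hs x : Finset.univ ⊆ s)) (by simpa using h)

theorem embedsIntoSimple_of_four_le (G Q R : Type u) [Group G] [Group Q] [Group R] [Finite Q]
    [Finite R] (hQ : 4 ≤ Nat.card Q) (hR : 3 ≤ Nat.card R) (hG : #G ≤ max ℵ₀ (max #Q #R)) :
    EmbedsIntoSimple G Q R := by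
  classical
  obtain ⟨g, hg⟩ := exists_notMem_of_lt_card ({1} : Finset Q) (by simp; omega)
  obtain ⟨q, hq⟩ := exists_notMem_of_lt_card ({1, g, g⁻¹} : Finset Q)
    (Finset.card_le_three.trans_lt hQ)
  obtain ⟨j₀, hj₀⟩ := exists_notMem_of_lt_card ({1} : Finset R) (by simp; omega)
  obtain ⟨j₁, hj₁⟩ := exists_notMem_of_lt_card ({1, j₀} : Finset R)
    (Finset.card_le_two.trans_lt hR)
  simp only [Finset.mem_insert, Finset.mem_singleton, not_or] at hg hq hj₀ hj₁
  have : Nontrivial R := ⟨j₀, 1, hj₀⟩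
  refine embedsIntoSimple_of_finite G hG hg {1, g} (by simp) (by simp) (q := q) ?_ ⟨j₀, hj₀⟩
    ⟨j₁, hj₁.1⟩ (k := g) (by simp) hg (by simpa using hj₁.2)
  rintro x (rfl | rfl) <;>
    simp only [Set.mem_insert_iff, Set.mem_singleton_iff, mul_one, _root_.mul_eq_right, not_or]
  · exact ⟨hq.1, hq.2.1⟩
  · exact ⟨fun h => hq.2.2 (eq_inv_of_mul_eq_one_left h), hq.1⟩

theorem embedsIntoSimple_of_six_le (G Q R : Type u) [Group G] [Group Q] [Group R] [Finite Q]
    [Finite R] [Nontrivial R] (hQ : 6 ≤ Nat.card Q) (hG : #G ≤ max ℵ₀ (max #Q #R)) :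
    EmbedsIntoSimple G Q R := by
  classical
  obtain ⟨r, hr⟩ := exists_ne (1 : R)
  suffices ∃ g h q : Q, g ≠ 1 ∧ h ≠ 1 ∧ h ≠ g ∧ q ≠ 1 ∧ q ≠ g ∧ q ≠ h ∧ q * g ≠ 1 ∧ q * g ≠ h ∧
      q * h ≠ 1 ∧ q * h ≠ g by
    obtain ⟨g, h, q, hg, hh, hhg, hq, hqg, hqh, h1, h2, h3, h4⟩ := this
    refine embedsIntoSimple_of_finite G hG hg {1, g, h} (by simp) (by simp) (q := q) ?_ ⟨r, hr⟩
      ⟨r, hr⟩ (k := h) (by simp) hh (by simpa using hhg)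
    rintro x (rfl | rfl | rfl) <;> simp [*]
  rcases Nat.lt_or_ge (Nat.card Q) 8 with h8 | h8
  · obtain h6 | h7 : Nat.card Q = 6 ∨ Nat.card Q = 7 := by omega
    · have : Fact (Nat.Prime 2) := ⟨Nat.prime_two⟩
      obtain ⟨q, hq⟩ := exists_prime_orderOf_dvd_card' (G := Q) 2 (by rw [h6]; decide)
      have hqq : q * q = 1 := by rw [← sq, ← hq, pow_orderOf_eq_one]
      have hq1 : q ≠ 1 := by rintro rfl; simp at hq
      obtain ⟨g, hg⟩ := exists_notMem_of_lt_card ({1, q} : Finset Q)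
        (Finset.card_le_two.trans_lt (by omega))
      obtain ⟨h, hh⟩ := exists_notMem_of_lt_card ({1, q, g, q * g} : Finset Q)
        (Finset.card_le_four.trans_lt (by omega))
      simp only [Finset.mem_insert, Finset.mem_singleton, not_or] at hg hh
      have hinv : ∀ a b : Q, q * a = b → a = q * b := fun a b e => by
        rw [← e, ← mul_assoc, hqq, one_mul]
      refine ⟨g, h, q, hg.1, hh.1, hh.2.2.1, hq1, Ne.symm hg.2, Ne.symm hh.2.1, fun e => hg.2 ?_,
        Ne.symm hh.2.2.2, fun e => hh.2.1 ?_, fun e => hh.2.2.2 (hinv _ _ e)⟩ <;>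
      · simpa using hinv _ _ e
    · have : Fact (Nat.Prime 7) := ⟨by norm_num⟩
      obtain ⟨q, hq⟩ := exists_prime_orderOf_dvd_card' (G := Q) 7 (by rw [h7])
      have key : ∀ m n, m < 7 → n < 7 → m ≠ n → q ^ m ≠ q ^ n := fun m n hm hn hmn e =>
        hmn (pow_injOn_Iio_orderOf (by simpa [hq]) (by simpa [hq]) e)
      have k0 : ∀ n, n < 7 → n ≠ 0 → q ^ n ≠ 1 := fun n hn h0 => by
        simpa using key n 0 hn (by norm_num) h0
      refine ⟨q ^ 2, q ^ 4, q, k0 _ ?_ ?_, k0 _ ?_ ?_, key _ _ ?_ ?_ ?_, ?_, ?_, ?_, ?_, ?_, ?_, ?_⟩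
      all_goals first | norm_num; done | skip
      · simpa using k0 1
      · simpa using key 1 2
      · simpa using key 1 4
      all_goals rw [← pow_succ']
      · exact k0 _ (by norm_num) (by norm_num)
      · exact key _ _ (by norm_num) (by norm_num) (by norm_num)
      · exact k0 _ (by norm_num) (by norm_num)
      · exact key _ _ (by norm_num) (by norm_num) (by norm_num)
  · obtain ⟨g, hg⟩ := exists_notMem_of_lt_card ({1} : Finset Q) (by simp; omega)
    obtain ⟨h, hh⟩ := exists_notMem_of_lt_card ({1, g} : Finset Q)
      (Finset.card_le_two.trans_lt (by omega))
    obtain ⟨q, hq⟩ := exists_notMem_of_lt_card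
      ({1, g, h, g⁻¹, h * g⁻¹, h⁻¹} ∪ {g * h⁻¹} : Finset Q)
      (lt_of_le_of_lt (Finset.card_union_le _ _)
        (by have := Finset.card_le_six (a := 1) (b := g) (c := h) (d := g⁻¹) (e := h * g⁻¹)
              (f := h⁻¹)
            simp only [Finset.card_singleton]; omega))
    simp only [Finset.mem_union, Finset.mem_insert, Finset.mem_singleton, not_or] at hg hh hq
    obtain ⟨⟨a1, a2, a3, a4, a5, a6⟩, a7⟩ := hq
    exact ⟨g, h, q, hg, hh.1, hh.2, a1, a2, a3, fun e => a4 (eq_inv_of_mul_eq_one_left e),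
      fun e => a5 (eq_mul_inv_of_mul_eq e), fun e => a6 (eq_inv_of_mul_eq_one_left e),
      fun e => a7 (eq_mul_inv_of_mul_eq e)⟩

end Ladder

/-- Base point and a sequence of copies of `ι`. -/
inductive Pt (ι : Type) : Type u
  | base : Pt ι
  | pt (x : ι) (n : ℕ) : Pt ι

namespace Pt
variable {ι : Type}

/-- The levelwise action of a permutation. -/
def act : Perm ι →* Perm (Pt.{u} ι) where
  toFun σ :=
    { toFun := fun | base => base | pt x n => pt (σ x) n
      invFun := fun | base => base | pt x n => pt (σ.symm x) n
      left_inv := by rintro (_ | _) <;> simp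
      right_inv := by rintro (_ | _) <;> simp }
  map_one' := by ext1 (_ | _) <;> rfl
  map_mul' σ τ := by ext1 (_ | _) <;> rfl

/-- The copies of `x`. -/
def column (x : ι) : Set (Pt.{u} ι) := {y | ∃ n, y = pt x n}

@[simp] theorem base_notMem_column (x : ι) : base ∉ column.{u} x := by
  rintro ⟨n, h⟩
  cases h

@[simp] theorem pt_mem_column {x z : ι} {n : ℕ} : pt z n ∈ column.{u} x ↔ z = x := by
  constructor
  · rintro ⟨m, h⟩
    cases h
    rfl
  · rintro rfl
    exact ⟨n, rfl⟩

theorem image_column {f : Perm (Pt.{u} ι)} {x x' : ι} (h : ∀ n, f (pt x n) = pt x' n) :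
    f '' column x = column x' := by
  ext y
  constructor
  · rintro ⟨_, ⟨n, rfl⟩, rfl⟩
    exact ⟨n, h n⟩
  · rintro ⟨n, rfl⟩
    exact ⟨_, ⟨n, rfl⟩, h n⟩

theorem disjoint_column {x x' : ι} (h : x ≠ x') : Disjoint (column.{u} x) (column x') := by
  rw [Set.disjoint_left]
  rintro _ ⟨n, rfl⟩ h'
  exact h (pt_mem_column.1 h')

/-- Some element of `T` acts like `f` outside of the fibres over the copies of `x`. -/
def HasClean {Λ : Type u} (T : Subgroup (Perm (Pt.{u} ι × Λ))) (f : Perm (Pt.{u} ι)) (x : ι) :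
    Prop :=
  ∃ t ∈ T, IsClean t f (column x)

section
variable {Λ : Type u} {T : Subgroup (Perm (Pt.{u} ι × Λ))} {f g : Perm (Pt.{u} ι)} {x x' y : ι}

theorem HasClean.conj (hf : HasClean T f x) (hg : HasClean T g y) (hxy : x ≠ y)
    (hfy : ∀ n, f (pt y n) = pt y n) (hgx : ∀ n, g (pt x n) = pt x' n) :
    HasClean T (g * f * g⁻¹) x' := by
  obtain ⟨s, hs, hsf⟩ := hf
  obtain ⟨t, ht, htg⟩ := hg
  refine ⟨_, T.mul_mem (T.mul_mem ht hs) (T.inv_mem ht), ?_⟩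
  rw [← image_column hgx]
  refine hsf.conj htg ?_ (disjoint_column hxy)
  rintro _ ⟨n, rfl⟩
  exact hfy n

theorem HasClean.conj_of_mem (hf : HasClean T f x) (hg : amplify Λ g ∈ T)
    (hgx : ∀ n, g (pt x n) = pt x' n) : HasClean T (g * f * g⁻¹) x' := by
  obtain ⟨s, hs, hsf⟩ := hf
  refine ⟨_, T.mul_mem (T.mul_mem hg hs) (T.inv_mem hg), ?_⟩
  rw [← image_column hgx]
  exact hsf.conj (isClean_amplify _ ∅) (by simp) (Set.disjoint_empty _)

theorem HasClean.commutator_mem (hf : HasClean T f x) (hg : HasClean T g y) (hxy : x ≠ y)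
    (hfx : ∀ n, f (pt x n) = pt x n) (hfy : ∀ n, f (pt y n) = pt y n)
    (hgx : ∀ n, g (pt x n) = pt x n) (hgy : ∀ n, g (pt y n) = pt y n) :
    amplify Λ ⁅f, g⁆ ∈ T := by
  obtain ⟨s, hs, hsf⟩ := hf
  obtain ⟨t, ht, htg⟩ := hg
  rw [← hsf.commutator htg (by rintro _ ⟨n, rfl⟩; exact hfx n) (by rintro _ ⟨n, rfl⟩; exact hfy n)
    (by rintro _ ⟨n, rfl⟩; exact hgx n) (by rintro _ ⟨n, rfl⟩; exact hgy n) (disjoint_column hxy)]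
  exact T.mul_mem (T.mul_mem (T.mul_mem hs ht) (T.inv_mem hs)) (T.inv_mem ht)

theorem HasClean.conj_mem (hg : HasClean T g x) (hf : amplify Λ f ∈ T)
    (hfx : ∀ n, f (pt x n) = pt x n) : amplify Λ (g * f * g⁻¹) ∈ T := by
  obtain ⟨t, ht, htg⟩ := hg
  have h1 := (isClean_amplify (Λ := Λ) f ∅).conj htg (by rintro _ ⟨n, rfl⟩; exact hfx n)
    (Set.empty_disjoint _)
  rw [Set.image_empty] at h1
  rw [← h1.eq_amplify]
  exact T.mul_mem (T.mul_mem ht hf) (T.inv_mem ht)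

end
end Pt

open Pt

/-- An involution of three copies of `A` with two transpositions and three marked fixed points. -/
structure Tile (A : Type) where
  a : A × Fin 3
  b : A × Fin 3
  c : A × Fin 3
  d : A × Fin 3
  inn : A × Fin 3
  out : A × Fin 3
  port : A × Fin 3

namespace Tile
variable {A : Type} (t : Tile A)

/-- The ports at the levels satisfying `c`. -/
def ports (c : ℕ → Prop) : Set (Pt.{u} (A × Fin 3)) := {y | ∃ n, y = pt t.port n ∧ c n}

theorem ports_union : ports.{u} t Even ∪ ports t (¬ Even ·) = column t.port := by
  ext y
  constructor
  · rintro (⟨n, rfl, -⟩ | ⟨n, rfl, -⟩) <;> exact ⟨n, rfl⟩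
  · rintro ⟨n, rfl⟩
    by_cases hn : Even n
    · exact Or.inl ⟨n, rfl, hn⟩
    · exact Or.inr ⟨n, rfl, hn⟩

section
variable [Group A]

/-- The levelwise action on the left. -/
def left : A →* Perm (Pt.{u} (A × Fin 3)) where
  toFun a := act (amplify (Fin 3) (Equiv.mulLeft a))
  map_one' := by ext1 (_ | ⟨⟨x, b⟩, n⟩) <;> simp
  map_mul' a a' := by ext1 (_ | ⟨⟨x, b⟩, n⟩) <;> simp

@[simp] theorem left_base (a : A) : left.{u} a base = base := rfl

@[simp] theorem left_pt (a x : A) (b : Fin 3) (n : ℕ) :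
    left.{u} a (pt (x, b) n) = pt (a * x, b) n := rfl

end

variable [DecidableEq A]

/-- The involution of a tile. -/
def link (x : A × Fin 3) : A × Fin 3 :=
  if x = t.a then t.b else if x = t.b then t.a else if x = t.c then t.d else
    if x = t.d then t.c else x

/-- The marked points are distinct, and the tile is connected. -/
structure IsGood : Prop where
  link_link : ∀ x, t.link (t.link x) = x
  link_inn : t.link t.inn = t.inn
  link_out : t.link t.out = t.out
  link_port : t.link t.port = t.port
  inn_ne_out : t.inn ≠ t.out
  inn_ne_port : t.inn ≠ t.port
  out_ne_port : t.out ≠ t.port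
  connected : ∀ s : Finset (Fin 3), s.Nonempty → (∀ x, x.2 ∈ s → (t.link x).2 ∈ s) →
    s = Finset.univ

/-- The tiles at all levels, joined in a chain. -/
def chain : Pt.{u} (A × Fin 3) → Pt.{u} (A × Fin 3)
  | base => pt t.inn 0
  | pt x 0 => if x = t.inn then base else if x = t.out then pt t.inn 1 else pt (t.link x) 0
  | pt x (n + 1) => if x = t.inn then pt t.out n else if x = t.out then pt t.inn (n + 2) else
      pt (t.link x) (n + 1)

theorem chain_base : t.chain base = pt.{u} t.inn 0 := rfl

theorem chain_inn_zero : t.chain (pt.{u} t.inn 0) = base := by simp [chain]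

theorem chain_inn_succ (n : ℕ) : t.chain (pt.{u} t.inn (n + 1)) = pt t.out n := by simp [chain]

variable {t}

theorem chain_pt {x : A × Fin 3} (hi : x ≠ t.inn) (ho : x ≠ t.out) (n : ℕ) :
    t.chain (pt.{u} x n) = pt (t.link x) n := by
  cases n <;> simp [chain, hi, ho]

theorem IsGood.chain_out (h : t.IsGood) (n : ℕ) :
    t.chain (pt.{u} t.out n) = pt t.inn (n + 1) := by
  cases n <;> simp [chain, h.inn_ne_out.symm]

theorem IsGood.chain_port (h : t.IsGood) (n : ℕ) : t.chain (pt.{u} t.port n) = pt t.port n := by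
  rw [chain_pt h.inn_ne_port.symm h.out_ne_port.symm, h.link_port]

theorem IsGood.chain_involutive (h : t.IsGood) : Function.Involutive (chain.{u} t) := by
  rintro (_ | ⟨x, n⟩)
  · rw [chain_base, chain_inn_zero]
  by_cases hi : x = t.inn
  · subst hi
    cases n with
    | zero => rw [chain_inn_zero, chain_base]
    | succ n => rw [chain_inn_succ, h.chain_out]
  by_cases ho : x = t.out
  · subst ho
    rw [h.chain_out, chain_inn_succ]
  · rw [chain_pt hi ho, chain_pt, h.link_link]
    · exact fun e => hi (by rw [← h.link_link x, e, h.link_inn])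
    · exact fun e => ho (by rw [← h.link_link x, e, h.link_out])

/-- The permutation joining the tiles. -/
def IsGood.perm (h : t.IsGood) : Perm (Pt.{u} (A × Fin 3)) := h.chain_involutive.toPerm

theorem IsGood.perm_mul_perm (h : t.IsGood) : h.perm * h.perm = (1 : Perm (Pt.{u} (A × Fin 3))) :=
  Equiv.ext h.chain_involutive

theorem IsGood.perm_port (h : t.IsGood) (n : ℕ) : h.perm (pt.{u} t.port n) = pt t.port n :=
  h.chain_port n

open scoped Classical in
/-- The action of a group of order two generated by the permutation joining the tiles. -/
noncomputable def IsGood.hom (h : t.IsGood) {R : Type u} [Group R] (hR : Nat.card R = 2) :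
    R →* Perm (Pt.{u} (A × Fin 3)) where
  toFun r := if r = 1 then 1 else h.perm
  map_one' := by simp
  map_mul' r s := by
    by_cases hr : r = 1
    · simp [hr]
    by_cases hs : s = 1
    · simp [hs]
    have hrs : r * s = 1 := by
      obtain ⟨x, y, hxy, huniv⟩ := Nat.card_eq_two_iff.1 hR
      have h1 : ∀ z : R, z = x ∨ z = y := fun z => by
        simpa using huniv.ge (Set.mem_univ z)
      rcases h1 1 with e | e <;> rcases h1 r with e1 | e1 <;> rcases h1 s with e2 | e2 <;>
        rcases h1 (r * s) with e3 | e3 <;> first | exact e3.trans e.symm | (exfalso; simp_all)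
    simp [hr, hs, hrs, h.perm_mul_perm]

theorem IsGood.hom_apply (h : t.IsGood) {R : Type u} [Group R] (hR : Nat.card R = 2) {r : R}
    (hr : r ≠ 1) : h.hom hR r = h.perm.{u} :=
  if_neg hr

variable [Group A]

theorem IsGood.eq_univ (h : t.IsGood) (s : Set (A × Fin 3)) (hs : s.Nonempty)
    (hleft : ∀ a, ∀ x ∈ s, (a * x.1, x.2) ∈ s)
    (hlink : ∀ x ∈ s, x ≠ t.inn → x ≠ t.out → t.link x ∈ s) (x : A × Fin 3) : x ∈ s := by
  classical
  have hall : ∀ x ∈ s, ∀ a, (a, x.2) ∈ s := fun x hx a => by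
    simpa using hleft (a * x.1⁻¹) x hx
  have huniv := h.connected (Finset.univ.filter fun i => ((1 : A), i) ∈ s) (by
    obtain ⟨y, hy⟩ := hs
    exact ⟨y.2, by simpa using hall y hy 1⟩) (by
    rintro ⟨a, i⟩ hi
    rw [Finset.mem_filter] at hi ⊢
    refine ⟨Finset.mem_univ _, hall _ ?_ 1⟩
    have ha := hall _ hi.2 a
    by_cases h1 : (a, i) = t.inn
    · rwa [h1, h.link_inn, ← h1]
    by_cases h2 : (a, i) = t.out
    · rwa [h2, h.link_out, ← h2]
    exact hlink _ ha h1 h2)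
  have hx := Finset.mem_univ x.2
  rw [← huniv] at hx
  exact hall _ (Finset.mem_filter.1 hx).2 x.1

/-- A three-cycle through the base point arises from the left action and the joining
permutation. -/
def IsGood.HasThreeCycle (h : t.IsGood) : Prop :=
  ∃ x y : Pt.{u} (A × Fin 3), x ≠ base ∧ y ≠ base ∧ x ≠ y ∧ x ∉ column t.port ∧ y ∉ column t.port ∧
    (h.perm x = x ∨ h.perm base = x) ∧
    ∀ (Λ : Type u) (T : Subgroup (Perm (Pt.{u} (A × Fin 3) × Λ))),
      (∀ a : A, amplify Λ (left a) ∈ T) → HasClean T h.perm t.port →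
      amplify Λ (threeCycle base x y) ∈ T

theorem IsGood.reach (h : t.IsGood) [Finite A] (D : Set (Pt.{u} (A × Fin 3)) → Prop)
    (hmono : ∀ A B, A ⊆ B → D B → D A) (hunion : ∀ A B, D A → D B → D (A ∪ B)) (hbase : D {base})
    (hα : ∀ (a : A) B, D B → D (left a '' B))
    (hρ : ∀ B, D B → Disjoint B (column t.port) → D (h.perm '' B)) (hD : D (ports t (¬ Even ·))) :
    D Set.univ := by
  have key : ∀ c : ℕ → Prop, (∃ x, D {y | ∃ n, y = pt x n ∧ c n}) →
      ∀ x, D {y | ∃ n, y = pt x n ∧ c n} := by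
    refine fun c hc => h.eq_univ {x | D {y | ∃ n, y = pt x n ∧ c n}} hc ?_ ?_
    · rintro a ⟨x, i⟩ hx
      refine hmono _ _ ?_ (hα a _ hx)
      rintro _ ⟨n, rfl, hn⟩
      exact ⟨_, ⟨n, rfl, hn⟩, rfl⟩
    · intro x hx hi ho
      by_cases hp : x = t.port
      · rwa [hp, h.link_port, ← hp]
      · refine hmono _ _ ?_ (hρ _ hx ?_)
        · rintro _ ⟨n, rfl, hn⟩
          exact ⟨_, ⟨n, rfl, hn⟩, chain_pt hi ho n⟩
        · rw [Set.disjoint_left]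
          rintro _ ⟨n, rfl, -⟩ h'
          exact hp (pt_mem_column.1 h')
  have hodd := key (¬ Even ·) ⟨t.port, hD⟩
  have heven := key Even ⟨t.out, hmono _ _ (by
    rintro _ ⟨n, rfl, hn⟩
    refine ⟨pt t.inn (n + 1), ⟨n + 1, rfl, by simpa [Nat.even_add_one] using hn⟩, ?_⟩
    exact t.chain_inn_succ n) (hρ _ (hodd t.inn) (by
      rw [Set.disjoint_left]
      rintro _ ⟨n, rfl, -⟩ h'
      exact h.inn_ne_port (pt_mem_column.1 h')))⟩
  refine hmono _ _ ?_ (hunion _ _ hbase (iUnion_of_finite hmono hunion base hbase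
    (Set.finite_univ (α := A × Fin 3)) _ fun x _ => hunion _ _ (hodd x) (heven x)))
  rintro (_ | ⟨x, n⟩) -
  · exact Or.inl rfl
  · refine Or.inr (Set.mem_biUnion (Set.mem_univ x) ?_)
    by_cases hn : Even n
    · exact Or.inr ⟨n, rfl, hn⟩
    · exact Or.inl ⟨n, rfl, hn⟩

/-- The gadget of a tile. -/
noncomputable def IsGood.gadget (h : t.IsGood) [Finite A] (ht : h.HasThreeCycle) {Q R : Type u}
    [Group Q] [Group R] (e : Q ≃* A) (hR : Nat.card R = 2) : Gadget Q R (Pt.{u} (A × Fin 3)) where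
  α := left.comp e.toMonoidHom
  ρ := h.hom hR
  codePort := ports t Even
  ctrlPort := ports t (¬ Even ·)
  disjoint := by
    rw [Set.disjoint_left]
    rintro _ ⟨n, rfl, hn⟩ ⟨m, hm, hm'⟩
    cases hm
    exact hm' hn
  fixed := by
    rw [ports_union]
    rintro r _ ⟨n, rfl⟩
    by_cases hr : r = 1
    · rw [hr, map_one, Perm.one_apply]
    · rw [h.hom_apply hR hr, h.perm_port]
  threeCycle_mem := by
    rw [ports_union]
    intro Λ ψ hψ T hα hT a b c hab hac hbc
    obtain ⟨x, y, hx, hy, hxy, hxp, hyp, hmeet, hw⟩ := ht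
    obtain ⟨r, hr⟩ := ((Nat.card_eq_two_iff' (1 : R)).1 hR).exists
    refine amplify_threeCycle_mem (left.comp e.toMonoidHom) (h.hom hR) (column t.port) ?_ ψ hψ T hα
      hT hx.symm hy.symm hxy (base_notMem_column _) hxp hyp (hw Λ T ?_ ?_) ?_ ?_ ?_ hab hac hbc
    · rintro r _ ⟨n, rfl⟩
      by_cases hr : r = 1
      · rw [hr, map_one, Perm.one_apply]
      · rw [h.hom_apply hR hr, h.perm_port]
    · intro a
      simpa using hα (e.symm a)
    · exact ⟨ψ r, hT r, h.hom_apply hR hr ▸ hψ r⟩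
    · exact fun q => rfl
    · intro r
      by_cases hr : r = 1
      · exact ⟨base, by simp, by simp [hr]⟩
      · rw [h.hom_apply hR hr]
        rcases hmeet with h' | h'
        · exact ⟨x, by simp, by simp [h']⟩
        · exact ⟨base, by simp, by simp [h']⟩
    · intro S hS hl hp
      have key : ∀ n, (∃ x, pt x n ∈ S) → ∀ x, pt x n ∈ S := by
        refine fun n hn => h.eq_univ {x | pt x n ∈ S} hn ?_ ?_
        · rintro a ⟨x, i⟩ hx
          simpa using hl (e.symm a) _ hx
        · intro x hx hi ho
          have := hp r _ hx
          rw [h.hom_apply hR hr] at this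
          rwa [Set.mem_ofPred_eq, ← chain_pt hi ho n]
      have hall : ∀ n x, pt x n ∈ S := by
        intro n
        induction n with
        | zero =>
          have := hp r _ hS
          rw [h.hom_apply hR hr] at this
          exact key 0 ⟨t.inn, this⟩
        | succ n ih =>
          have := hp r _ (ih t.out)
          rw [h.hom_apply hR hr] at this
          exact key _ ⟨t.inn, h.chain_out n ▸ this⟩
      ext (_ | ⟨x, n⟩)
      · simpa using hS
      · simpa using hall n x
  reach := by
    rw [ports_union]
    intro D hmono hunion hsing hα hρ hD
    obtain ⟨r, hr⟩ := ((Nat.card_eq_two_iff' (1 : R)).1 hR).exists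
    refine h.reach D hmono hunion (hsing _) (fun a B hB => ?_) (fun B hB hdisj => ?_) hD
    · simpa using hα (e.symm a) B hB
    · simpa only [h.hom_apply hR hr] using hρ r B hB hdisj
  mk_le := by
    have := Finite.of_equiv A e.symm.toEquiv
    have : Finite R := Nat.finite_of_card_ne_zero (by omega)
    have hcount : Countable (Pt.{u} (A × Fin 3)) := by
      refine Function.Surjective.countable
        (f := fun o : Option ((A × Fin 3) × ℕ) => o.elim base fun a => pt a.1 a.2) ?_
      rintro (_ | ⟨x, n⟩)
      · exact ⟨none, rfl⟩
      · exact ⟨some (x, n), rfl⟩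
    refine le_trans (max_le mk_le_aleph0 (max_le le_rfl (max_le mk_le_aleph0 mk_le_aleph0))) ?_
    have := Infinite.of_injective
      (fun n : ℕ => (⟨_, 2 * n, rfl, even_two_mul n⟩ : ports.{u} t Even))
      fun m n h => by simpa [Subtype.ext_iff] using h
    exact aleph0_le_mk _
  ctrlPort_nontrivial := ⟨_, ⟨1, rfl, by decide⟩, _, ⟨3, rfl, by decide⟩, by simp⟩
  compl_nontrivial := by
    rw [ports_union]
    exact ⟨base, base_notMem_column _, pt t.inn 0, by simp [h.inn_ne_port], by simp⟩
  moves q hq := ⟨pt (1, 0) 0, pt (1, 0) 1, pt (1, 0) 2, by simp [hq]⟩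

end Tile

namespace Tile
variable {A : Type} {t : Tile A} [Group A]

theorem amplify_conj_mem {Λ : Type u} {T : Subgroup (Perm (Pt.{u} (A × Fin 3) × Λ))}
    (hα : ∀ a : A, amplify Λ (left a) ∈ T) (a : A) {s : Perm (Pt.{u} (A × Fin 3))}
    (hs : amplify Λ s ∈ T) : amplify Λ (left a * s * (left a)⁻¹) ∈ T := by
  simp only [map_mul, map_inv]
  exact T.mul_mem (T.mul_mem (hα a) hs) (T.inv_mem (hα a))

variable [DecidableEq A]

theorem IsGood.hasThreeCycle (h : t.IsGood) (s g : Perm (Pt.{u} (A × Fin 3))) (a : A)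
    (hmem : ∀ (Λ : Type u) (T : Subgroup (Perm (Pt.{u} (A × Fin 3) × Λ))),
      (∀ a : A, amplify Λ (left a) ∈ T) → HasClean T h.perm t.port →
      amplify Λ s ∈ T ∧ amplify Λ g ∈ T)
    (hsg : ∀ y, y ≠ base → s y = y ∨ g y = y) {x y : A × Fin 3} {m n : ℕ}
    (hs : left a (s base) = pt x m) (hg : left a (g base) = pt y n) (hxy : x ≠ y)
    (hx : x ≠ t.port) (hy : y ≠ t.port)
    (hmeet : h.perm (pt.{u} x m) = pt x m ∨ h.perm base = pt.{u} x m) :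
    IsGood.HasThreeCycle.{u} h := by
  refine ⟨pt x m, pt y n, by simp, by simp, by simp [hxy], by simp [hx], by simp [hy], hmeet,
    fun Λ T hα hT => ?_⟩
  obtain ⟨hsT, hgT⟩ := hmem Λ T hα hT
  have hs' : s base ≠ base := fun e => by simp [e] at hs
  have hg' : g base ≠ base := fun e => by simp [e] at hg
  have e : threeCycle base (pt x m) (pt y n) = left a * ⁅s, g⁆ * (left a)⁻¹ := by
    rw [commutator_eq_threeCycle hs' hg' hsg, conj_threeCycle, left_base, hs, hg]
  rw [e, commutatorElement_def]
  simp only [map_mul, map_inv]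
  exact T.mul_mem (T.mul_mem (hα a) (T.mul_mem (T.mul_mem (T.mul_mem hsT hgT) (T.inv_mem hsT))
    (T.inv_mem hgT))) (T.inv_mem (hα a))

theorem IsGood.commutator_mem (h : t.IsGood) {Λ : Type u}
    {T : Subgroup (Perm (Pt.{u} (A × Fin 3) × Λ))} (hα : ∀ a : A, amplify Λ (left a) ∈ T)
    (hT : HasClean T h.perm t.port) (a : A) {x : A × Fin 3}
    (hx : ∀ n, left a (pt.{u} t.port n) = pt x n) (hne : t.port ≠ x)
    (h1 : ∀ n, h.perm (pt.{u} x n) = pt x n)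
    (h2 : ∀ n, (left a * h.perm * (left a)⁻¹) (pt.{u} t.port n) = pt t.port n) :
    amplify Λ ⁅h.perm, left a * h.perm * (left a)⁻¹⁆ ∈ T := by
  refine hT.commutator_mem (hT.conj_of_mem (hα a) hx) hne h.perm_port h1 h2 fun n => ?_
  rw [← hx, Perm.mul_apply, Perm.mul_apply,
    show (left a)⁻¹ (left a (pt.{u} t.port n)) = pt t.port n from (left a).symm_apply_apply _,
    h.perm_port]

open Multiplicative (ofAdd)

/-- A tile for the cyclic group of order five. -/
def cyclicFive : Tile (Multiplicative (ZMod 5)) where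
  a := (ofAdd 4, 0)
  b := (ofAdd 0, 2)
  c := (ofAdd 2, 0)
  d := (ofAdd 0, 1)
  inn := (ofAdd 0, 0)
  out := (ofAdd 2, 1)
  port := (ofAdd 2, 2)

set_option maxRecDepth 10000 in
theorem cyclicFive_isGood : cyclicFive.IsGood where
  link_link := by decide
  link_inn := by decide
  link_out := by decide
  link_port := by decide
  inn_ne_out := by decide
  inn_ne_port := by decide
  out_ne_port := by decide
  connected := by decide

/-- An involution moving the base point. -/
def cyclicFiveSwap : Perm (Pt.{u} (Multiplicative (ZMod 5) × Fin 3)) :=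
  ⁅cyclicFive_isGood.perm, left (ofAdd 1) * cyclicFive_isGood.perm * (left (ofAdd 1))⁻¹⁆ ^ 3

set_option maxRecDepth 100000 in
theorem cyclicFive_hasThreeCycle : IsGood.HasThreeCycle.{u} cyclicFive_isGood := by
  refine cyclicFive_isGood.hasThreeCycle cyclicFiveSwap
    (left (ofAdd 2) * cyclicFiveSwap * (left (ofAdd 2))⁻¹) 1
    (x := (ofAdd 0, 0)) (y := (ofAdd 2, 0)) (m := 0) (n := 0) (fun Λ T hα hT => ?_) ?_
    (by rfl) (by rfl) (by decide) (by decide) (by decide) (Or.inr (by rfl))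
  · have hs : amplify Λ cyclicFiveSwap ∈ T := by
      simp only [cyclicFiveSwap, map_pow]
      refine T.pow_mem (cyclicFive_isGood.commutator_mem hα hT (ofAdd 1) (x := (ofAdd 3, 2))
        (fun n => rfl) (by decide) ?_ ?_) 3 <;> rintro (_ | _) <;> rfl
    exact ⟨hs, amplify_conj_mem hα (ofAdd 2) hs⟩
  · rintro (_ | ⟨⟨a, b⟩, n⟩) hy
    · exact absurd rfl hy
    · revert hy
      revert a
      intro (a : ZMod 5) _
      fin_cases a <;> fin_cases b <;> rcases n with _ | _ | _ | n <;>
        first | (left; rfl) | (right; rfl)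

/-- A tile for a group of order four, where `w` is an involution and `a` a further element. -/
def ofOrderFour {A : Type} [Group A] (w a : A) : Tile A where
  a := (w, 0)
  b := (1, 2)
  c := (a, 0)
  d := (1, 1)
  inn := (1, 0)
  out := (a, 1)
  port := (a, 2)

theorem cyclicFour_isGood : (ofOrderFour (ofAdd (2 : ZMod 4)) (ofAdd 1)).IsGood where
  link_link := by decide
  link_inn := by decide
  link_out := by decide
  link_port := by decide
  inn_ne_out := by decide
  inn_ne_port := by decide
  out_ne_port := by decide
  connected := by decide

/-- An involution moving the base point. -/
def cyclicFourSwap : Perm (Pt.{u} (Multiplicative (ZMod 4) × Fin 3)) :=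
  ⁅cyclicFour_isGood.perm, left (ofAdd 2) * cyclicFour_isGood.perm * (left (ofAdd 2))⁻¹⁆ ^ 3

set_option maxRecDepth 100000 in
theorem cyclicFour_hasThreeCycle : IsGood.HasThreeCycle.{u} cyclicFour_isGood := by
  refine cyclicFour_isGood.hasThreeCycle cyclicFourSwap
    (left (ofAdd 1) * cyclicFourSwap * (left (ofAdd 1))⁻¹) (ofAdd 2)
    (x := (ofAdd 2, 2)) (y := (ofAdd 3, 2)) (m := 0) (n := 0) (fun Λ T hα hT => ?_) ?_
    (by rfl) (by rfl) (by decide) (by decide) (by decide) (Or.inl (by rfl))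
  · have hs : amplify Λ cyclicFourSwap ∈ T := by
      simp only [cyclicFourSwap, map_pow]
      refine T.pow_mem (cyclicFour_isGood.commutator_mem hα hT (ofAdd 2) (x := (ofAdd 3, 2))
        (fun n => rfl) (by decide) ?_ ?_) 3 <;> rintro (_ | _) <;> rfl
    exact ⟨hs, amplify_conj_mem hα (ofAdd 1) hs⟩
  · rintro (_ | ⟨⟨a, b⟩, n⟩) hy
    · exact absurd rfl hy
    · revert hy
      revert a
      intro (a : ZMod 4) _
      fin_cases a <;> fin_cases b <;> rcases n with _ | _ | _ | n <;>
        first | (left; rfl) | (right; rfl)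

theorem kleinFour_isGood :
    (ofOrderFour (ofAdd ((1, 0) : ZMod 2 × ZMod 2)) (ofAdd (0, 1))).IsGood where
  link_link := by decide
  link_inn := by decide
  link_out := by decide
  link_port := by decide
  inn_ne_out := by decide
  inn_ne_port := by decide
  out_ne_port := by decide
  connected := by decide

/-- An involution moving the base point. -/
def kleinFourSwap : Perm (Pt.{u} (Multiplicative (ZMod 2 × ZMod 2) × Fin 3)) :=
  ⁅kleinFour_isGood.perm,
    left (ofAdd (1, 0)) * kleinFour_isGood.perm * (left (ofAdd (1, 0)))⁻¹⁆ ^ 3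

set_option maxRecDepth 100000 in
theorem kleinFour_hasThreeCycle : IsGood.HasThreeCycle.{u} kleinFour_isGood := by
  refine kleinFour_isGood.hasThreeCycle kleinFourSwap
    (left (ofAdd (0, 1)) * kleinFourSwap * (left (ofAdd (0, 1)))⁻¹) (ofAdd (1, 0))
    (x := (ofAdd (1, 0), 2)) (y := (ofAdd (1, 1), 2)) (m := 0) (n := 0) (fun Λ T hα hT => ?_) ?_
    (by rfl) (by rfl) (by decide) (by decide) (by decide) (Or.inl (by rfl))
  · have hs : amplify Λ kleinFourSwap ∈ T := by
      simp only [kleinFourSwap, map_pow]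
      refine T.pow_mem (kleinFour_isGood.commutator_mem hα hT (ofAdd (1, 0))
        (x := (ofAdd (1, 1), 2)) (fun n => rfl) (by decide) ?_ ?_) 3 <;> rintro (_ | _) <;> rfl
    exact ⟨hs, amplify_conj_mem hα (ofAdd (0, 1)) hs⟩
  · rintro (_ | ⟨⟨⟨a, a'⟩, b⟩, n⟩) hy
    · exact absurd rfl hy
    · revert hy
      revert a a'
      intro (a : ZMod 2) (a' : ZMod 2) _
      fin_cases a <;> fin_cases a' <;> fin_cases b <;> rcases n with _ | _ | _ | n <;>
        first | (left; rfl) | (right; rfl)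

/-- A tile for the cyclic group of order three. -/
def cyclicThree : Tile (Multiplicative (ZMod 3)) where
  a := (ofAdd 1, 1)
  b := (ofAdd 0, 2)
  c := (ofAdd 1, 2)
  d := (ofAdd 2, 0)
  inn := (ofAdd 1, 0)
  out := (ofAdd 0, 0)
  port := (ofAdd 0, 1)

theorem cyclicThree_isGood : cyclicThree.IsGood where
  link_link := by decide
  link_inn := by decide
  link_out := by decide
  link_port := by decide
  inn_ne_out := by decide
  inn_ne_port := by decide
  out_ne_port := by decide
  connected := by decide

/-- A conjugate of the permutation joining the tiles. -/
def cyclicThreeConj : Perm (Pt.{u} (Multiplicative (ZMod 3) × Fin 3)) :=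
  left (ofAdd 2) * cyclicThree_isGood.perm * (left (ofAdd 2))⁻¹

/-- An involution moving the base point. -/
def cyclicThreeSwap : Perm (Pt.{u} (Multiplicative (ZMod 3) × Fin 3)) :=
  ⁅cyclicThree_isGood.perm,
    cyclicThreeConj * cyclicThree_isGood.perm * cyclicThreeConj⁻¹⁆ ^ 3

/-- A conjugate of `cyclicThreeSwap`. -/
def cyclicThreeSwapConj : Perm (Pt.{u} (Multiplicative (ZMod 3) × Fin 3)) :=
  left (ofAdd 2) * cyclicThreeSwap * (left (ofAdd 2))⁻¹

/-- A conjugate of a commutator of conjugates of `cyclicThreeSwap`. -/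
def cyclicThreeCycle : Perm (Pt.{u} (Multiplicative (ZMod 3) × Fin 3)) :=
  cyclicThree_isGood.perm * ⁅left (ofAdd 1) * cyclicThreeSwap * (left (ofAdd 1))⁻¹,
    cyclicThreeSwapConj⁆ * cyclicThree_isGood.perm⁻¹

set_option maxRecDepth 100000 in
theorem cyclicThree_hasThreeCycle : IsGood.HasThreeCycle.{u} cyclicThree_isGood := by
  refine cyclicThree_isGood.hasThreeCycle cyclicThreeSwapConj cyclicThreeCycle (ofAdd 2)
    (x := (ofAdd 1, 0)) (y := (ofAdd 0, 2)) (m := 0) (n := 1) (fun Λ T hα hT => ?_) ?_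
    (by rfl) (by rfl) (by decide) (by decide) (by decide) (Or.inr (by rfl))
  · have hs : amplify Λ cyclicThreeSwap ∈ T := by
      simp only [cyclicThreeSwap, map_pow]
      have hσ : HasClean T cyclicThreeConj (ofAdd 2, 1) :=
        hT.conj_of_mem (hα (ofAdd 2)) fun n => rfl
      have hσρ : HasClean T (cyclicThreeConj * cyclicThree_isGood.perm * cyclicThreeConj⁻¹)
          (ofAdd 2, 2) := by
        refine hT.conj hσ (by decide) ?_ ?_ <;> rintro (_ | _) <;> rfl
      refine T.pow_mem (hT.commutator_mem hσρ (by decide) ?_ ?_ ?_ ?_) 3 <;>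
        rintro (_ | _ | _) <;> rfl
    have hf : amplify Λ cyclicThreeSwapConj ∈ T := amplify_conj_mem hα _ hs
    have hv := amplify_conj_mem hα (ofAdd 1) hs
    refine ⟨hf, hT.conj_mem ?_ ?_⟩
    · rw [commutatorElement_def, map_mul, map_mul, map_mul, map_inv, map_inv]
      exact T.mul_mem (T.mul_mem (T.mul_mem hv hf) (T.inv_mem hv)) (T.inv_mem hf)
    · rintro (_ | _ | _ | _) <;> rfl
  · rintro (_ | ⟨⟨a, b⟩, n⟩) hy
    · exact absurd rfl hy
    · revert hy
      revert a
      intro (a : ZMod 3) _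
      fin_cases a <;> fin_cases b <;> rcases n with _ | _ | _ | _ | n <;>
        first | (left; rfl) | (right; rfl)

end Tile

/-- A tile gives the embedding when one group has order two. -/
theorem Tile.IsGood.embedsIntoSimple {A : Type} {t : Tile A} [DecidableEq A] [Group A] [Finite A]
    (h : t.IsGood) (ht : IsGood.HasThreeCycle.{u} h) {G Q R : Type u} [Group G] [Group Q] [Group R]
    (e : Q ≃* A) (hR : Nat.card R = 2) (hG : #G ≤ max ℵ₀ (max #Q #R)) :
    EmbedsIntoSimple G Q R :=
  have : Nontrivial R := by
    have : Finite R := Nat.finite_of_card_ne_zero (by omega)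
    exact Finite.one_lt_card_iff_nontrivial.1 (by omega)
  (h.gadget ht e hR).embedsIntoSimple G hG

theorem embedsIntoSimple_of_card_lt_six {G Q R : Type u} [Group G] [Group Q] [Group R]
    (h3 : 3 ≤ Nat.card Q) (h6 : Nat.card Q < 6) (hR : Nat.card R = 2)
    (hG : #G ≤ max ℵ₀ (max #Q #R)) : EmbedsIntoSimple G Q R := by
  have hfin : Finite Q := Nat.finite_of_card_ne_zero (by omega)
  have key : ∀ n, Nat.card Q = n → IsCyclic Q →
      Nonempty (Q ≃* Multiplicative (ZMod n)) := fun n hn _ =>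
    ⟨by subst hn; exact (zmodCyclicMulEquiv ‹IsCyclic Q›).symm⟩
  obtain h | h | h : Nat.card Q = 3 ∨ Nat.card Q = 5 ∨ Nat.card Q = 4 := by omega
  · have : Fact (Nat.Prime 3) := ⟨Nat.prime_three⟩
    obtain ⟨e⟩ := key 3 h (isCyclic_of_prime_card h)
    exact Tile.cyclicThree_isGood.embedsIntoSimple Tile.cyclicThree_hasThreeCycle e hR hG
  · have : Fact (Nat.Prime 5) := ⟨Nat.prime_five⟩
    obtain ⟨e⟩ := key 5 h (isCyclic_of_prime_card h)
    exact Tile.cyclicFive_isGood.embedsIntoSimple Tile.cyclicFive_hasThreeCycle e hR hG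
  · by_cases hc : IsCyclic Q
    · obtain ⟨e⟩ := key 4 h hc
      exact Tile.cyclicFour_isGood.embedsIntoSimple Tile.cyclicFour_hasThreeCycle e hR hG
    · have : IsKleinFour Q := ⟨h, by
        have : Nontrivial Q := Finite.one_lt_card_iff_nontrivial.1 (by omega)
        refine (Monoid.exponent_eq_prime_iff Nat.prime_two).2 fun g hg => ?_
        have hd : orderOf g ∣ 2 ^ 2 := by
          simpa [h] using orderOf_dvd_natCard g
        obtain ⟨k, hk, hk'⟩ := (Nat.dvd_prime_pow Nat.prime_two).1 hd
        interval_cases k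
        · exact absurd (orderOf_eq_one_iff.1 hk') hg
        · exact hk'
        · exact absurd (isCyclic_of_orderOf_eq_card g (by rw [hk', h]; norm_num)) hc⟩
      obtain ⟨e⟩ := IsKleinFour.nonempty_mulEquiv (G₁ := Q)
        (G₂ := Multiplicative (ZMod 2 × ZMod 2))
      exact Tile.kleinFour_isGood.embedsIntoSimple Tile.kleinFour_hasThreeCycle e hR hG

theorem embedsIntoSimple_of_card_eq_three {G Q R : Type u} [Group G] [Group Q] [Group R]
    (hQ : Nat.card Q = 3) (hR : Nat.card R = 3) (hG : #G ≤ ℵ₀) : EmbedsIntoSimple G Q R := by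
  have : Fact (Nat.Prime 3) := ⟨Nat.prime_three⟩
  have : Finite Q := Nat.finite_of_card_ne_zero (by omega)
  have : Nontrivial Q := Finite.one_lt_card_iff_nontrivial.1 (by omega)
  let e : R ≃* Q := mulEquivOfPrimeCardEq (p := 3) hR hQ
  obtain ⟨S, _, hS, hφ, ψ, χ, hψ, hχ, hgen⟩ := embedsIntoSimple_of_card_lt_six (G := G) (Q := Q)
    (R := ULift.{u} (Multiplicative (ZMod 2))) hQ.ge (by omega) (by simp)
    (hG.trans (le_max_left _ _))
  let a : S := χ ⟨Multiplicative.ofAdd 1⟩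
  have haa : a * a = 1 := by
    rw [← map_mul, ← map_one χ]
    rfl
  have hχa : ∀ r, χ r = 1 ∨ χ r = a := by
    rintro ⟨r⟩
    revert r
    intro (r : ZMod 2)
    fin_cases r
    · exact Or.inl (map_one χ)
    · exact Or.inr rfl
  have ha : a⁻¹ = a := inv_eq_of_mul_eq_one_left haa
  let χ' : R →* S := (MulAut.conj a).toMonoidHom.comp (ψ.comp e.toMonoidHom)
  have hχ' : ∀ r, χ' r = a * ψ (e r) * a := fun r => by
    simp [χ', MulAut.conj_apply, ha]
  refine ⟨S, _, hS, hφ, ψ, χ', hψ,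
    (MulAut.conj a).injective.comp (hψ.comp e.injective), ?_⟩
  set N := Subgroup.closure (Set.range ψ ∪ Set.range χ') with hN
  have hψN : ∀ q, ψ q ∈ N := fun q => Subgroup.subset_closure (Or.inl ⟨q, rfl⟩)
  have hχN : ∀ q, a * ψ q * a ∈ N := fun q =>
    Subgroup.subset_closure (Or.inr ⟨e.symm q, by rw [hχ', e.apply_symm_apply]⟩)
  have hnorm : N.Normal := by
    rw [← Subgroup.normalizer_eq_top_iff, eq_top_iff, ← hgen, Subgroup.closure_le]
    rintro _ (⟨q, rfl⟩ | ⟨r, rfl⟩)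
    · exact Subgroup.le_normalizer (hψN q)
    · have haN : ∀ x ∈ N, a * x * a⁻¹ ∈ N := by
        intro x hx
        have hle : N ≤ N.comap (MulAut.conj a).toMonoidHom := by
          rw [hN, Subgroup.closure_le, ← hN]
          rintro _ (⟨q, rfl⟩ | ⟨r, rfl⟩)
          · simpa [MulAut.conj_apply, ha] using hχN q
          · have : a * (a * ψ (e r) * a) * a = ψ (e r) := by
              rw [← mul_assoc, ← mul_assoc, haa, one_mul, mul_assoc, haa, mul_one]
            simpa [MulAut.conj_apply, ha, hχ', this] using hψN (e r)
        simpa [MulAut.conj_apply] using hle hx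
      obtain h | h := hχa r
      · rw [h]
        exact Subgroup.one_mem _
      · rw [h]
        refine Subgroup.mem_normalizer_iff.2 fun x => ⟨haN x, fun hx => ?_⟩
        have := haN _ hx
        rw [ha, ← mul_assoc, ← mul_assoc, haa, one_mul, mul_assoc, haa, mul_one] at this
        exact this
  obtain h | h := hnorm.eq_bot_or_eq_top
  · obtain ⟨q, hq⟩ := exists_ne (1 : Q)
    have := hψN q
    rw [h, Subgroup.mem_bot] at this
    exact absurd (hψ (this.trans (map_one ψ).symm)) hq
  · exact h

theorem mk_coprod_le (H K : Type u) [Group H] [Group K] :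
    #(Monoid.Coprod H K) ≤ max ℵ₀ (max #H #K) := by
  refine (mk_le_of_surjective Monoid.Coprod.mk_surjective).trans ((mk_list_le_max (H ⊕ K)).trans ?_)
  rw [mk_sum, lift_id, lift_id]
  exact max_le (le_max_left _ _) ((add_le_max _ _).trans
    (max_le (le_max_right _ _) (le_max_left _ _)))

theorem embedsIntoSimple {G H K : Type u} [Group G] [Group H] [Group K] [Nontrivial H]
    [Nontrivial K] (hK : 3 ≤ #K) (hG : #G ≤ max ℵ₀ (max #H #K)) : EmbedsIntoSimple G H K := by
  have hG' : #G ≤ max ℵ₀ (max #K #H) := by rwa [max_comm #K]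
  cases finite_or_infinite H with
  | inr _ => exact Ladder.embedsIntoSimple_of_infinite G H K hG
  | inl _ =>
    cases finite_or_infinite K with
    | inr _ => exact (Ladder.embedsIntoSimple_of_infinite G K H hG').symm
    | inl _ =>
      have hK3 : 3 ≤ Nat.card K := by
        rw [← Nat.cast_card] at hK
        exact_mod_cast hK
      have hH2 : 2 ≤ Nat.card H := Finite.one_lt_card
      by_cases hH4 : 4 ≤ Nat.card H
      · exact Ladder.embedsIntoSimple_of_four_le G H K hH4 hK3 hG
      obtain hH | hH : Nat.card H = 3 ∨ Nat.card H = 2 := by omega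
      · by_cases hK4 : 4 ≤ Nat.card K
        · exact (Ladder.embedsIntoSimple_of_four_le G K H hK4 hH.ge hG').symm
        · exact embedsIntoSimple_of_card_eq_three hH (by omega)
            (hG.trans (max_le le_rfl (max_le mk_le_aleph0 mk_le_aleph0)))
      · by_cases hK6 : 6 ≤ Nat.card K
        · exact (Ladder.embedsIntoSimple_of_six_le G K H hK6 hG').symm
        · exact (embedsIntoSimple_of_card_lt_six hK3 (by omega) hH hG').symm

end SchuppEmbedding

/-- Theorem S (Schupp): if `G`, `H`, `K` are nontrivial groups with `|K| ≥ 3` and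
`|G| ≤ |H ∗ K|` (where `H ∗ K` is the free product, i.e. the coproduct of groups),
then there is a simple group `S` containing an isomorphic copy of `G` and generated
by isomorphic copies of `H` and `K`. -/
theorem schupp_embedding_into_simple_group
    (G H K : Type u) [Group G] [Group H] [Group K]
    [Nontrivial G] [Nontrivial H] [Nontrivial K]
    (hK : 3 ≤ Cardinal.mk K)
    (hG : Cardinal.mk G ≤ Cardinal.mk (Monoid.Coprod H K)) :
    ∃ (S : Type u) (_ : Group S),
      IsSimpleGroup S ∧
      (∃ φ : G →* S, Function.Injective φ) ∧
      ∃ (ψ : H →* S) (χ : K →* S),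
        Function.Injective ψ ∧ Function.Injective χ ∧
        Subgroup.closure (Set.range ψ ∪ Set.range χ) = ⊤ :=
  SchuppEmbedding.embedsIntoSimple hK (hG.trans (SchuppEmbedding.mk_coprod_le H K))
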